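/- Let n ≥ 2 and let v : (0,∞) → [0,∞) be measurable with v(r) ≤ n ω_n r^{n-1} for H^1-a.e. r, such that F_v is a set of finite perimeter and finite volume. Then for every r̄ > 0, the slice ∂*F_v ∩ ∂B(0,r̄) is H^{n-1}-equivalent to **B**_{α_v^∨(r̄)}(r̄ e₁) \ **B**_{α_v^∧(r̄)}(r̄ e₁). -/

import Mathlib

/- Common definitions: geometric measure theory notions (density points, essential
boundary, perimeter, reduced boundary and measure-theoretic outer unit normal),
spherical and circular symmetrisation, BV and Sobolev-type notions. -/

open MeasureTheory Metric Set Filter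
open scoped ENNReal NNReal Topology RealInnerProductSpace

noncomputable section

/-- Euclidean space `ℝⁿ`. -/
abbrev Euc (n : ℕ) : Type := EuclideanSpace ℝ (Fin n)

/-- `ω_k`: the volume of the unit ball of `ℝ^k`. -/
def omegaBall (k : ℕ) : ℝ := (volume (ball (0 : Euc k) 1)).toReal

/-- The radial unit vector `x̂ = x/|x|`. -/
def hatv {n : ℕ} (x : Euc n) : Euc n := ‖x‖⁻¹ • x

/-- The first vector of the canonical basis. -/
def e1 (n : ℕ) (hn : 0 < n) : Euc n := EuclideanSpace.single ⟨0, hn⟩ 1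

/-- `E` has `n`-dimensional density `t` at `x`. -/
def DensityAt {n : ℕ} (E : Set (Euc n)) (x : Euc n) (t : ℝ≥0∞) : Prop :=
  Tendsto (fun ρ : ℝ => volume (E ∩ ball x ρ) / volume (ball x ρ)) (𝓝[>] (0:ℝ)) (𝓝 t)

/-- The essential boundary `∂ᵉE`: points of density neither `0` nor `1`. -/
def essBoundary {n : ℕ} (E : Set (Euc n)) : Set (Euc n) :=
  {x | ¬ DensityAt E x 0 ∧ ¬ DensityAt E x 1}

/-- The perimeter of `E` relative to `A`: `P(E;A) = H^{n-1}(∂ᵉE ∩ A)`. -/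
def perim {n : ℕ} (E A : Set (Euc n)) : ℝ≥0∞ := μH[(n : ℝ) - 1] (essBoundary E ∩ A)

/-- `ν` is the measure-theoretic outer unit normal of `E` at `x`: the blow-up of `E`
at `x` is the half space `{y : (y-x)·ν ≤ 0}` in density. -/
def HasMTNormal {n : ℕ} (E : Set (Euc n)) (x ν : Euc n) : Prop :=
  ‖ν‖ = 1 ∧
    Tendsto (fun ρ : ℝ =>
        volume ({y | y ∈ E ∧ 0 < ⟪y - x, ν⟫} ∩ ball x ρ) / volume (ball x ρ))
      (𝓝[>] (0:ℝ)) (𝓝 0) ∧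
    Tendsto (fun ρ : ℝ =>
        volume ({y | y ∉ E ∧ ⟪y - x, ν⟫ < 0} ∩ ball x ρ) / volume (ball x ρ))
      (𝓝[>] (0:ℝ)) (𝓝 0)

/-- The reduced boundary `∂*E`. -/
def redBoundary {n : ℕ} (E : Set (Euc n)) : Set (Euc n) := {x | ∃ ν, HasMTNormal E x ν}

/-- The measure-theoretic outer unit normal `ν^E`. -/
def mtNormal {n : ℕ} (E : Set (Euc n)) (x : Euc n) : Euc n :=
  haveI := Classical.propDecidable (∃ ν, HasMTNormal E x ν)
  if h : ∃ ν, HasMTNormal E x ν then h.choose else 0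

/-- The tangential component `ν∥^E(x) = ν^E(x) - (ν^E(x)·x̂)x̂` of the normal along
the sphere `∂B(|x|)`. -/
def nuPar {n : ℕ} (E : Set (Euc n)) (x : Euc n) : Euc n :=
  mtNormal E x - ⟪mtNormal E x, hatv x⟫ • hatv x

/-- The open geodesic ball (spherical cap) `B_β(r p)` in the sphere `∂B(0,r)`. -/
def capSet {n : ℕ} (p : Euc n) (r β : ℝ) : Set (Euc n) :=
  {x | x ∈ sphere (0 : Euc n) r ∧ Real.arccos ⟪hatv x, p⟫ < β}

/-- The geodesic sphere `S_β(r p)` in the sphere `∂B(0,r)`. -/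
def capSphere {n : ℕ} (p : Euc n) (r β : ℝ) : Set (Euc n) :=
  {x | x ∈ sphere (0 : Euc n) r ∧ Real.arccos ⟪hatv x, p⟫ = β}

/-- `E ⊆ ℝⁿ` is spherically `v`-distributed: `H^{n-1}(E ∩ ∂B(0,r)) = v r` for a.e. `r > 0`. -/
def SphDistrib {n : ℕ} (v : ℝ → ℝ) (E : Set (Euc n)) : Prop :=
  ∀ᵐ r ∂(volume.restrict (Ioi (0:ℝ))),
    μH[(n : ℝ) - 1] (E ∩ sphere (0 : Euc n) r) = ENNReal.ofReal (v r)

/-- The spherical symmetral `F_v` (determined by the angle function `α = α_v` and the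
direction `p`). -/
def sphSymm (n : ℕ) (α : ℝ → ℝ) (p : Euc n) : Set (Euc n) :=
  {x : Euc n | x ≠ 0 ∧ Real.arccos ⟪hatv x, p⟫ < α ‖x‖}

/-- `Φ(B × S^{n-1})`, for `B ⊆ (0,∞)`. -/
def sphShell (n : ℕ) (B : Set ℝ) : Set (Euc n) := {x : Euc n | x ≠ 0 ∧ ‖x‖ ∈ B}

/-- `v ∈ BV(0,∞)`: `v` is integrable on `(0,∞)` and has a representative of bounded
pointwise variation there. -/
def BVIoi (v : ℝ → ℝ) : Prop :=
  IntegrableOn v (Ioi (0:ℝ)) volume ∧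
    ∃ w : ℝ → ℝ, (∀ᵐ r ∂(volume.restrict (Ioi (0:ℝ))), w r = v r) ∧
      BoundedVariationOn w (Ioi (0:ℝ))

/-- `f ∈ W^{1,1}_loc(I)` for `I ⊆ ℝ`: `f` has a representative `w` which is locally
absolutely continuous on `I`, i.e. `w b - w a = ∫_a^b g` with `g` locally integrable on `I`. -/
def W11locOn (f : ℝ → ℝ) (I : Set ℝ) : Prop :=
  ∃ w g : ℝ → ℝ, (∀ᵐ r ∂(volume.restrict I), w r = f r) ∧
    LocallyIntegrableOn g I volume ∧
    ∀ a b : ℝ, uIcc a b ⊆ I → w b - w a = ∫ t in a..b, g t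

/-- `S ⊆ ℝ` has one-dimensional density `0` at `x`. -/
def RDensity0 (S : Set ℝ) (x : ℝ) : Prop :=
  Tendsto (fun ρ : ℝ => volume (S ∩ ball x ρ) / volume (ball x ρ)) (𝓝[>] (0:ℝ)) (𝓝 0)

/-- The approximate upper limit `f^∨(x)` (for bounded `f`). -/
def apSup (f : ℝ → ℝ) (x : ℝ) : ℝ := sInf {t : ℝ | RDensity0 {y | t < f y} x}

/-- The approximate lower limit `f^∧(x)` (for bounded `f`). -/
def apInf (f : ℝ → ℝ) (x : ℝ) : ℝ := sSup {t : ℝ | RDensity0 {y | f y < t} x}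

/-- `t` is the approximate limit of `f` at `x` with respect to `A`. -/
def apLimOn (f : ℝ → ℝ) (A : Set ℝ) (x t : ℝ) : Prop :=
  ∀ ε : ℝ, 0 < ε → RDensity0 ({y | ε < |f y - t|} ∩ A) x

/-- Density (with value `t`) at `x` of a subset `A` of the sphere `∂B(0,r)`,
with respect to the measure `H^{n-1}` on the sphere. -/
def SphDensityAt {n : ℕ} (A : Set (Euc n)) (r : ℝ) (x : Euc n) (t : ℝ≥0∞) : Prop :=
  Tendsto (fun ρ : ℝ =>
      μH[(n : ℝ) - 1] (A ∩ ball x ρ) / μH[(n : ℝ) - 1] (sphere (0 : Euc n) r ∩ ball x ρ))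
    (𝓝[>] (0:ℝ)) (𝓝 t)

/-- The essential boundary, within the sphere `∂B(0,r)`, of a subset `A` of that sphere. -/
def sphEssBoundary {n : ℕ} (A : Set (Euc n)) (r : ℝ) : Set (Euc n) :=
  {x | x ∈ sphere (0 : Euc n) r ∧ ¬ SphDensityAt A r x 0 ∧ ¬ SphDensityAt A r x 1}

/-- A pair of mutually singular measures `(σp, σm)` supported in `(0,∞)`, locally finite
there, representing the distributional derivative `Dξ = σp - σm` of `ξ` on `(0,∞)`. -/
def RepDeriv (ξ : ℝ → ℝ) (σp σm : Measure ℝ) : Prop :=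
  σp (Iic (0:ℝ)) = 0 ∧ σm (Iic (0:ℝ)) = 0 ∧
    (∀ K : Set ℝ, K ⊆ Ioi (0:ℝ) → IsCompact K → σp K < ⊤ ∧ σm K < ⊤) ∧
    σp.MutuallySingular σm ∧
    ∀ φ : ℝ → ℝ, ContDiff ℝ 1 φ → HasCompactSupport φ → tsupport φ ⊆ Ioi (0:ℝ) →
      (∫ r in Ioi (0:ℝ), ξ r * deriv φ r) = (∫ r, φ r ∂σm) - ∫ r, φ r ∂σp

/-- The density `ξ'` of the absolutely continuous part of `Dξ = σp - σm`. -/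
def acDeriv (σp σm : Measure ℝ) (r : ℝ) : ℝ :=
  (σp.rnDeriv volume r).toReal - (σm.rnDeriv volume r).toReal

/-- `p_E(r) = H^{n-2}(∂*E ∩ ∂B(0,r))` (as a real number). -/
def pSlice {n : ℕ} (E : Set (Euc n)) (r : ℝ) : ℝ :=
  (μH[(n : ℝ) - 2] (redBoundary E ∩ sphere (0 : Euc n) r)).toReal

/-- The projection `x ↦ x₁₂` onto the plane of the first two coordinates. -/
def pr12 {n : ℕ} (hn : 2 ≤ n) (x : Euc n) : Euc 2 :=
  (EuclideanSpace.equiv (Fin 2) ℝ).symm fun i => x ⟨i.1, lt_of_lt_of_le i.2 hn⟩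

/-- The projection `x ↦ x'` onto the remaining `n - 2` coordinates. -/
def prC {n : ℕ} (hn : 2 ≤ n) (x : Euc n) : Euc (n - 2) :=
  (EuclideanSpace.equiv (Fin (n - 2)) ℝ).symm fun i => x ⟨i.1 + 2, by have := i.2; omega⟩

/-- The circle `∂B((0,x'),r) ∩ Π_{x'}`, for `p = (r, x')`. -/
def circFiber {n : ℕ} (hn : 2 ≤ n) (p : ℝ × Euc (n - 2)) : Set (Euc n) :=
  {y : Euc n | prC hn y = p.2 ∧ ‖pr12 hn y‖ = p.1}

/-- The circular slice `E_{(r,x')}`, for `p = (r, x')`. -/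
def cslice {n : ℕ} (hn : 2 ≤ n) (E : Set (Euc n)) (p : ℝ × Euc (n - 2)) : Set (Euc n) :=
  E ∩ circFiber hn p

/-- `E` is circularly `ℓ`-distributed. -/
def CircDistrib {n : ℕ} (hn : 2 ≤ n) (ℓ : ℝ × Euc (n - 2) → ℝ) (E : Set (Euc n)) : Prop :=
  ∀ᵐ p ∂(volume.restrict ((Ioi (0:ℝ)) ×ˢ (univ : Set (Euc (n - 2))))),
    μH[(1:ℝ)] (cslice hn E p) = ENNReal.ofReal (ℓ p)

/-- The circular symmetral `F^ℓ`. -/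
def circSymm {n : ℕ} (hn : 2 ≤ n) (ℓ : ℝ × Euc (n - 2) → ℝ) : Set (Euc n) :=
  {x : Euc n | pr12 hn x ≠ 0 ∧
    Real.arccos ⟪hatv (pr12 hn x), e1 2 (by norm_num)⟫
      < ℓ (‖pr12 hn x‖, prC hn x) / (2 * ‖pr12 hn x‖)}

/-- `Φ₁₂(B × S¹)`, for `B ⊆ (0,∞) × ℝ^{n-2}`. -/
def cylSet {n : ℕ} (hn : 2 ≤ n) (B : Set (ℝ × Euc (n - 2))) : Set (Euc n) :=
  {x : Euc n | pr12 hn x ≠ 0 ∧ (‖pr12 hn x‖, prC hn x) ∈ B}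

/-- The component `ν₁₂∥^E(x) = ν₁₂^E(x) - (ν^E(x)·x̂₁₂)x̂₁₂` of the normal. -/
def nu12par {n : ℕ} (hn : 2 ≤ n) (E : Set (Euc n)) (x : Euc n) : Euc 2 :=
  pr12 hn (mtNormal E x) - ⟪pr12 hn (mtNormal E x), hatv (pr12 hn x)⟫ • hatv (pr12 hn x)

/-- Density (with value `t`) at `x` of a subset `A` of the circle `circFiber hn p`,
with respect to the measure `H¹` on that circle. -/
def CircDensityAt {n : ℕ} (hn : 2 ≤ n) (A : Set (Euc n)) (p : ℝ × Euc (n - 2)) (x : Euc n)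
    (t : ℝ≥0∞) : Prop :=
  Tendsto (fun ρ : ℝ => μH[(1:ℝ)] (A ∩ ball x ρ) / μH[(1:ℝ)] (circFiber hn p ∩ ball x ρ))
    (𝓝[>] (0:ℝ)) (𝓝 t)

/-- The essential boundary, within the circle `circFiber hn p`, of a subset `A`. -/
def circEssBoundary {n : ℕ} (hn : 2 ≤ n) (A : Set (Euc n)) (p : ℝ × Euc (n - 2)) :
    Set (Euc n) :=
  {x | x ∈ circFiber hn p ∧ ¬ CircDensityAt hn A p x 0 ∧ ¬ CircDensityAt hn A p x 1}

/-- `f` has locally bounded variation on the open set `Ω`: on every open `U` compactly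
contained in `Ω` the distributional gradient of `f` has finite total variation. -/
def BVlocOn {W : Type*} [NormedAddCommGroup W] [NormedSpace ℝ W] [MeasureSpace W]
    (f : W → ℝ) (Ω : Set W) : Prop :=
  LocallyIntegrableOn f Ω volume ∧
    ∀ U : Set W, IsOpen U → IsCompact (closure U) → closure U ⊆ Ω →
      ∃ C : ℝ, ∀ g : W → W, ContDiff ℝ 1 g → HasCompactSupport g → tsupport g ⊆ U →
        (∀ x, ‖g x‖ ≤ 1) →
        (∫ x in U, f x * LinearMap.trace ℝ W (fderiv ℝ g x).toLinearMap) ≤ C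

/-- `f ∈ W^{1,1}_loc(Ω)` for `Ω ⊆ (0,∞) × ℝ^m`: `f` has a locally integrable weak
gradient `(g1, g2)` on `Ω`. -/
def W11locProd {m : ℕ} (f : ℝ × Euc m → ℝ) (Ω : Set (ℝ × Euc m)) : Prop :=
  ∃ (g1 : ℝ × Euc m → ℝ) (g2 : ℝ × Euc m → Euc m),
    LocallyIntegrableOn f Ω volume ∧ LocallyIntegrableOn g1 Ω volume ∧
      LocallyIntegrableOn g2 Ω volume ∧
      ∀ φ : ℝ × Euc m → ℝ, ContDiff ℝ 1 φ → HasCompactSupport φ → tsupport φ ⊆ Ω →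
        ∀ y : ℝ × Euc m,
          (∫ x in Ω, f x * fderiv ℝ φ x y) = -∫ x in Ω, φ x * (g1 x * y.1 + ⟪g2 x, y.2⟫)

/-- A pair of mutually singular measures `(σp, σm)` supported in `Ω₀ = (0,∞) × ℝ^m`,
locally finite there, representing the partial distributional derivative
`D_r ξ = σp - σm` of `ξ` in the radial variable. -/
def RepDerivR {m : ℕ} (ξ : ℝ × Euc m → ℝ) (σp σm : Measure (ℝ × Euc m)) : Prop :=
  σp ((Ioi (0:ℝ)) ×ˢ (univ : Set (Euc m)))ᶜ = 0 ∧
    σm ((Ioi (0:ℝ)) ×ˢ (univ : Set (Euc m)))ᶜ = 0 ∧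
    (∀ K : Set (ℝ × Euc m), K ⊆ (Ioi (0:ℝ)) ×ˢ univ → IsCompact K → σp K < ⊤ ∧ σm K < ⊤) ∧
    σp.MutuallySingular σm ∧
    ∀ φ : ℝ × Euc m → ℝ, ContDiff ℝ 1 φ → HasCompactSupport φ →
      tsupport φ ⊆ (Ioi (0:ℝ)) ×ˢ (univ : Set (Euc m)) →
      (∫ x in (Ioi (0:ℝ)) ×ˢ (univ : Set (Euc m)), ξ x * fderiv ℝ φ x ((1:ℝ), (0 : Euc m)))
        = (∫ x, φ x ∂σm) - ∫ x, φ x ∂σp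

/-- A polar representation `(τ, h)` (with `‖h‖ = 1` `τ`-a.e.) of the distributional
gradient `D_{x'} f = h τ` of `f` in the `x'` variables, on `Ω₀ = (0,∞) × ℝ^m`. -/
def RepDerivX {m : ℕ} (f : ℝ × Euc m → ℝ) (τ : Measure (ℝ × Euc m))
    (h : ℝ × Euc m → Euc m) : Prop :=
  τ ((Ioi (0:ℝ)) ×ˢ (univ : Set (Euc m)))ᶜ = 0 ∧
    (∀ K : Set (ℝ × Euc m), K ⊆ (Ioi (0:ℝ)) ×ˢ univ → IsCompact K → τ K < ⊤) ∧
    (∀ᵐ x ∂τ, ‖h x‖ = 1) ∧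
    ∀ φ : ℝ × Euc m → ℝ, ContDiff ℝ 1 φ → HasCompactSupport φ →
      tsupport φ ⊆ (Ioi (0:ℝ)) ×ˢ (univ : Set (Euc m)) →
      ∀ y : Euc m,
        (∫ x in (Ioi (0:ℝ)) ×ˢ (univ : Set (Euc m)), f x * fderiv ℝ φ x ((0:ℝ), y))
          = -∫ x, φ x * ⟪h x, y⟫ ∂τ

/-- The barycentre function `b_E(r) = r^{1-n} ∫_{E_r} x̂ dH^{n-1}`. -/
def bary (n : ℕ) (E : Set (Euc n)) (r : ℝ) : Euc n :=
  (r ^ (n - 1))⁻¹ • ∫ x in E ∩ sphere (0 : Euc n) r, hatv x ∂μH[(n : ℝ) - 1]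

/-- The average direction `d_E(r)` of the slice `E_r`. -/
def avgDir (n : ℕ) (α : ℝ → ℝ) (E : Set (Euc n)) (r : ℝ) : Euc n :=
  (omegaBall (n - 1) * Real.sin (α r) ^ (n - 1) * r ^ (n - 1))⁻¹ •
    ∫ x in E ∩ sphere (0 : Euc n) r, hatv x ∂μH[(n : ℝ) - 1]

end

/-! ### Polar coordinates -/

lemma aux_dist_hat {n : ℕ} {x y : Euc n} (hx : x ≠ 0) (hy : y ≠ 0) :
    ‖hatv y - hatv x‖ ≤ 2 * ‖y - x‖ / ‖x‖ := by
  have hx' : 0 < ‖x‖ := norm_pos_iff.2 hx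
  have hy' : 0 < ‖y‖ := norm_pos_iff.2 hy
  have e : hatv y - hatv x = ‖x‖⁻¹ • ((‖x‖ - ‖y‖) • hatv y + (y - x)) := by
    unfold hatv
    rw [smul_add, smul_sub, smul_smul, smul_smul, ← add_sub_assoc]
    congr 1
    rw [← add_smul]
    congr 1
    field_simp
    ring
  have h1 : ‖hatv y‖ = 1 := by
    unfold hatv; rw [norm_smul, norm_inv, norm_norm, inv_mul_cancel₀ hy'.ne']
  rw [e, norm_smul, norm_inv, norm_norm, div_eq_inv_mul]
  gcongr
  calc _ ≤ ‖(‖x‖ - ‖y‖) • hatv y‖ + ‖y - x‖ := norm_add_le _ _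
    _ ≤ ‖y - x‖ + ‖y - x‖ := by
      gcongr
      rw [norm_smul, h1, mul_one, Real.norm_eq_abs, norm_sub_rev y x]
      exact abs_norm_sub_norm_le x y
    _ = _ := by ring

lemma aux_norm_hat {n : ℕ} {x : Euc n} (hx : x ≠ 0) : ‖hatv x‖ = 1 := by
  have hx' : 0 < ‖x‖ := norm_pos_iff.2 hx
  unfold hatv; rw [norm_smul, norm_inv, norm_norm, inv_mul_cancel₀ hx'.ne']

lemma aux_eq_smul_hat {n : ℕ} {x : Euc n} (hx : x ≠ 0) : x = ‖x‖ • hatv x := by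
  have hx' : 0 < ‖x‖ := norm_pos_iff.2 hx
  unfold hatv; rw [smul_smul, mul_inv_cancel₀ hx'.ne', one_smul]

lemma aux_polar {n : ℕ} (U : Set (Euc n)) :
    ∃ c : ℝ≥0∞, ∀ A : Set ℝ, MeasurableSet A → A ⊆ Ioi 0 →
      volume {y : Euc n | hatv y ∈ U ∧ ‖y‖ ∈ A} =
        c * ∫⁻ t in A, ENNReal.ofReal (t ^ (n - 1)) := by
  refine ⟨(volume : Measure (Euc n)).toSphere (Subtype.val ⁻¹' U), fun A hA hA0 => ?_⟩
  have h := (volume : Measure (Euc n)).measurePreserving_homeomorphUnitSphereProd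
  have h2 := h.measure_preimage_emb (Homeomorph.measurableEmbedding _)
    ((Subtype.val ⁻¹' U) ×ˢ (Subtype.val ⁻¹' A))
  rw [Measure.prod_prod, comap_subtype_coe_apply (measurableSet_singleton _).compl] at h2
  have e1 : Measure.volumeIoiPow (Module.finrank ℝ (Euc n) - 1) (Subtype.val ⁻¹' A) =
      ∫⁻ t in A, ENNReal.ofReal (t ^ (n - 1)) := by
    rw [Measure.volumeIoiPow, withDensity_apply _ (measurable_subtype_coe hA),
      setLIntegral_subtype measurableSet_Ioi _ fun a : ℝ ↦ .ofReal (a ^ _),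
      Subtype.image_preimage_coe, inter_eq_right.2 hA0, finrank_euclideanSpace_fin]
  rw [e1] at h2
  rw [← h2]
  congr 1
  ext y
  simp only [mem_ofPred_eq, mem_image, mem_preimage, mem_prod, Subtype.exists]
  constructor
  · rintro ⟨h1, h3⟩
    have hy : y ≠ 0 := by
      rintro rfl
      have := hA0 h3
      simp at this
    exact ⟨y, hy, ⟨by simpa [hatv] using h1, by simpa using h3⟩, rfl⟩
  · rintro ⟨a, ha, h1, rfl⟩
    exact ⟨by simpa [hatv] using h1.1, by simpa using h1.2⟩

lemma aux_cross {n : ℕ} (U : Set (Euc n)) {s : ℝ} (hs : 0 < s) {A I : Set ℝ}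
    (hA : MeasurableSet A) (hI : MeasurableSet I) (hAs : A ⊆ Ioo (s/2) (2*s))
    (hIs : I ⊆ Ioo (s/2) (2*s)) :
    volume {y : Euc n | hatv y ∈ U ∧ ‖y‖ ∈ A} * volume I ≤
      4 ^ (n - 1) * volume A * volume {y : Euc n | hatv y ∈ U ∧ ‖y‖ ∈ I} := by
  obtain ⟨c, hc⟩ := aux_polar U
  have h0 : Ioo (s/2) (2*s) ⊆ Ioi 0 := fun t ht => lt_trans (by positivity) ht.1
  rw [hc A hA (hAs.trans h0), hc I hI (hIs.trans h0)]
  have e1 : ∫⁻ t in A, ENNReal.ofReal (t ^ (n - 1)) ≤ ENNReal.ofReal ((2*s)^(n-1)) * volume A := by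
    rw [← setLIntegral_const]
    refine setLIntegral_mono' hA fun t ht => ENNReal.ofReal_le_ofReal ?_
    exact pow_le_pow_left₀ (h0 (hAs ht)).le (hAs ht).2.le _
  have e2 : ENNReal.ofReal ((s/2)^(n-1)) * volume I ≤ ∫⁻ t in I, ENNReal.ofReal (t ^ (n - 1)) := by
    rw [← setLIntegral_const]
    refine setLIntegral_mono' hI fun t ht => ENNReal.ofReal_le_ofReal ?_
    exact pow_le_pow_left₀ (by positivity) (hIs ht).1.le _
  have e3 : ENNReal.ofReal ((2*s)^(n-1)) = 4 ^ (n-1) * ENNReal.ofReal ((s/2)^(n-1)) := by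
    rw [show (4 : ℝ≥0∞) = ENNReal.ofReal 4 by simp, ← ENNReal.ofReal_pow (by norm_num),
      ← ENNReal.ofReal_mul (by positivity), ← mul_pow]
    congr 2; ring
  calc _ ≤ c * (ENNReal.ofReal ((2*s)^(n-1)) * volume A) * volume I := by gcongr
    _ = 4 ^ (n-1) * volume A * (c * (ENNReal.ofReal ((s/2)^(n-1)) * volume I)) := by
      rw [e3]; ring
    _ ≤ _ := by gcongr

/-- Upper bound. -/
lemma aux_upper {n : ℕ} (hn : 2 ≤ n) (x : Euc n) (hx : x ≠ 0) {A : Set ℝ} (hA : MeasurableSet A)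
    {ρ : ℝ} (hρ : 0 < ρ) (hρx : ρ < ‖x‖ / 2) :
    volume ({y : Euc n | ‖y‖ ∈ A} ∩ ball x ρ) / volume (ball x ρ) ≤
      (4 ^ (n - 1) * 3 ^ n) * (volume (A ∩ ball ‖x‖ ρ) / volume (ball ‖x‖ ρ)) := by
  have hx' : 0 < ‖x‖ := norm_pos_iff.2 hx
  have : Nonempty (Fin n) := ⟨⟨0, by omega⟩⟩
  have hsub : ball ‖x‖ ρ ⊆ Ioo (‖x‖/2) (2*‖x‖) := by
    rw [Real.ball_eq_Ioo]
    exact Ioo_subset_Ioo (by linarith) (by linarith)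
  have h := aux_cross (n := n) (ball (hatv x) (2 * ρ / ‖x‖)) hx' (hA.inter measurableSet_ball)
    (measurableSet_ball (x := ‖x‖) (ε := ρ)) (inter_subset_right.trans hsub) hsub
  have hb : ∀ y ∈ ball x ρ, y ≠ 0 := by
    rintro y hy rfl
    rw [mem_ball, dist_zero_left] at hy
    linarith
  have h1 : {y : Euc n | ‖y‖ ∈ A} ∩ ball x ρ ⊆
      {y : Euc n | hatv y ∈ ball (hatv x) (2 * ρ / ‖x‖) ∧ ‖y‖ ∈ A ∩ ball ‖x‖ ρ} := by
    rintro y ⟨hyA, hy⟩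
    have hy' := hy
    rw [mem_ball, dist_eq_norm] at hy
    refine ⟨?_, hyA, ?_⟩
    · rw [mem_ball, dist_eq_norm]
      refine (aux_dist_hat hx (hb y hy')).trans_lt ?_
      gcongr
    · rw [mem_ball, Real.dist_eq]
      exact (abs_norm_sub_norm_le y x).trans_lt hy
  have h2 : {y : Euc n | hatv y ∈ ball (hatv x) (2 * ρ / ‖x‖) ∧ ‖y‖ ∈ ball ‖x‖ ρ} ⊆
      ball x (3 * ρ) := by
    rintro y ⟨hy1, hy2⟩
    have hy0 : y ≠ 0 := by
      rintro rfl
      rw [mem_ball, Real.dist_eq, norm_zero, zero_sub, abs_neg, abs_of_pos hx'] at hy2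
      linarith
    rw [mem_ball, dist_eq_norm] at hy1 ⊢
    rw [mem_ball, Real.dist_eq] at hy2
    have e : y - x = (‖y‖ - ‖x‖) • hatv y + ‖x‖ • (hatv y - hatv x) := by
      conv_lhs => rw [aux_eq_smul_hat hy0, aux_eq_smul_hat hx]
      module
    calc ‖y - x‖ ≤ ‖(‖y‖ - ‖x‖) • hatv y‖ + ‖‖x‖ • (hatv y - hatv x)‖ := by
          rw [e]; exact norm_add_le _ _
      _ = |‖y‖ - ‖x‖| + ‖x‖ * ‖hatv y - hatv x‖ := by
          rw [norm_smul, norm_smul, aux_norm_hat hy0, norm_norm, mul_one, Real.norm_eq_abs]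
      _ < ρ + ‖x‖ * (2 * ρ / ‖x‖) := by gcongr
      _ = 3 * ρ := by field_simp; ring
  have h3 : volume (ball x (3 * ρ)) = 3 ^ n * volume (ball x ρ) := by
    rw [Measure.addHaar_ball_mul _ x (by norm_num : (0:ℝ) ≤ 3), finrank_euclideanSpace_fin,
      Measure.addHaar_ball_center _ x, ENNReal.ofReal_pow (by norm_num)]
    simp
  have hv0 : volume (ball x ρ) ≠ 0 := (measure_ball_pos _ _ hρ).ne'
  have hvt : volume (ball x ρ) ≠ ⊤ := measure_ball_lt_top.ne
  have hw0 : volume (ball ‖x‖ ρ) ≠ 0 := (measure_ball_pos _ _ hρ).ne'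
  have hwt : volume (ball ‖x‖ ρ) ≠ ⊤ := measure_ball_lt_top.ne
  rw [ENNReal.div_le_iff hv0 hvt, ← mul_div_assoc, ← ENNReal.mul_div_right_comm,
    ENNReal.le_div_iff_mul_le (Or.inl hw0) (Or.inl hwt)]
  calc _ ≤ _ := mul_le_mul_left (measure_mono h1) _
    _ ≤ _ := h
    _ ≤ 4 ^ (n - 1) * volume (A ∩ ball ‖x‖ ρ) * volume (ball x (3 * ρ)) := by gcongr
    _ = _ := by rw [h3]; ring

/-- Lower bound. -/
lemma aux_lower {n : ℕ} (hn : 2 ≤ n) (x : Euc n) (hx : x ≠ 0) {A : Set ℝ} (hA : MeasurableSet A)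
    (V : Set (Euc n)) (κ : ℝ) (hκ : 0 < κ) 
    {ρ : ℝ} (hρ : 0 < ρ) (hρx : ρ < ‖x‖ / 2)
    (hV : ∃ z, ball z (κ * ρ) ⊆ ball x (ρ/4) ∩ {y | hatv y ∈ V}) :
    volume (A ∩ ball ‖x‖ (ρ/2)) / volume (ball ‖x‖ (ρ/2)) ≤ 
      (4 ^ (n - 1) * ENNReal.ofReal (κ ^ n)⁻¹) * 
      (volume ({y : Euc n | hatv y ∈ V ∧ ‖y‖ ∈ A} ∩ ball x ρ) / volume (ball x ρ)) := by
  have hx' : 0 < ‖x‖ := norm_pos_iff.2 hx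
  have : Nonempty (Fin n) := ⟨⟨0, by omega⟩⟩
  obtain ⟨z, hz⟩ := hV
  have hsub : ball ‖x‖ (ρ/2) ⊆ Ioo (‖x‖/2) (2*‖x‖) := by
    rw [Real.ball_eq_Ioo]
    exact Ioo_subset_Ioo (by linarith) (by linarith)
  have h := aux_cross (n := n) (ball (hatv x) (ρ / 2 / ‖x‖) ∩ V) hx' 
    (measurableSet_ball (x := ‖x‖) (ε := ρ/2)) (hA.inter measurableSet_ball)
     hsub (inter_subset_right.trans hsub)
  have h1 : ball z (κ * ρ) ⊆
      {y : Euc n | hatv y ∈ ball (hatv x) (ρ / 2 / ‖x‖) ∩ V ∧ ‖y‖ ∈ ball ‖x‖ (ρ/2)} := by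
    intro y hy
    obtain ⟨hy1, hy2⟩ := hz hy
    rw [mem_ball, dist_eq_norm] at hy1
    have hy0 : y ≠ 0 := by
      rintro rfl
      rw [zero_sub, norm_neg] at hy1
      linarith
    refine ⟨⟨?_, hy2⟩, ?_⟩
    · rw [mem_ball, dist_eq_norm]
      refine (aux_dist_hat hx hy0).trans_lt ?_
      gcongr
      linarith
    · rw [mem_ball, Real.dist_eq]
      exact (abs_norm_sub_norm_le y x).trans_lt (by linarith)
  have h2 : {y : Euc n | hatv y ∈ ball (hatv x) (ρ / 2 / ‖x‖) ∩ V ∧ ‖y‖ ∈ A ∩ ball ‖x‖ (ρ/2)} ⊆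
      {y : Euc n | hatv y ∈ V ∧ ‖y‖ ∈ A} ∩ ball x ρ := by
    rintro y ⟨⟨hy1, hyV⟩, hyA, hy2⟩
    refine ⟨⟨hyV, hyA⟩, ?_⟩
    have hy0 : y ≠ 0 := by
      rintro rfl
      rw [mem_ball, Real.dist_eq, norm_zero, zero_sub, abs_neg, abs_of_pos hx'] at hy2
      linarith
    rw [mem_ball, dist_eq_norm] at hy1 ⊢
    rw [mem_ball, Real.dist_eq] at hy2
    have e : y - x = (‖y‖ - ‖x‖) • hatv y + ‖x‖ • (hatv y - hatv x) := by
      conv_lhs => rw [aux_eq_smul_hat hy0, aux_eq_smul_hat hx]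
      module
    calc ‖y - x‖ ≤ ‖(‖y‖ - ‖x‖) • hatv y‖ + ‖‖x‖ • (hatv y - hatv x)‖ := by
          rw [e]; exact norm_add_le _ _
      _ = |‖y‖ - ‖x‖| + ‖x‖ * ‖hatv y - hatv x‖ := by
          rw [norm_smul, norm_smul, aux_norm_hat hy0, norm_norm, mul_one, Real.norm_eq_abs]
      _ < ρ/2 + ‖x‖ * (ρ / 2 / ‖x‖) := by gcongr
      _ = ρ := by field_simp; ring
  have h3 : volume (ball x ρ) = ENNReal.ofReal (κ ^ n)⁻¹ * volume (ball z (κ * ρ)) := by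
    rw [Measure.addHaar_ball_mul _ z hκ.le, finrank_euclideanSpace_fin,
      Measure.addHaar_ball_center _ x, ← mul_assoc, ← ENNReal.ofReal_mul (by positivity),
      inv_mul_cancel₀ (by positivity)]
    simp
  have hv0 : volume (ball x ρ) ≠ 0 := (measure_ball_pos _ _ hρ).ne'
  have hvt : volume (ball x ρ) ≠ ⊤ := measure_ball_lt_top.ne
  have hw0 : volume (ball ‖x‖ (ρ/2)) ≠ 0 := (measure_ball_pos _ _ (by positivity)).ne'
  have hwt : volume (ball ‖x‖ (ρ/2)) ≠ ⊤ := measure_ball_lt_top.ne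
  rw [ENNReal.div_le_iff hw0 hwt, ← mul_div_assoc, ← ENNReal.mul_div_right_comm,
    ENNReal.le_div_iff_mul_le (Or.inl hv0) (Or.inl hvt)]
  calc _ = ENNReal.ofReal (κ ^ n)⁻¹ * (volume (ball z (κ * ρ)) * volume (A ∩ ball ‖x‖ (ρ/2))) := by
        rw [h3]; ring
    _ ≤ ENNReal.ofReal (κ ^ n)⁻¹ * _ := mul_le_mul_right (mul_le_mul_left (measure_mono h1) _) _
    _ ≤ _ := mul_le_mul_right h _
    _ ≤ ENNReal.ofReal (κ ^ n)⁻¹ * (_ * _) :=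
      mul_le_mul_right (mul_le_mul_right (measure_mono h2) _) _
    _ = _ := by ring

/-! ### Density lemmas -/

/-- `E` has density zero at `x`, uniform notation. -/
def auxD0 {n : ℕ} (E : Set (Euc n)) (x : Euc n) : Prop :=
  Tendsto (fun ρ : ℝ => volume (E ∩ ball x ρ) / volume (ball x ρ)) (𝓝[>] (0:ℝ)) (𝓝 0)

lemma auxD0_mono_ev {n : ℕ} {E G : Set (Euc n)} {x : Euc n} (h : auxD0 G x)
    (hEG : ∀ᶠ y in 𝓝 x, y ∈ E → y ∈ G) : auxD0 E x := by
  refine tendsto_of_tendsto_of_tendsto_of_le_of_le' tendsto_const_nhds h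
    (Eventually.of_forall fun _ => zero_le) ?_
  obtain ⟨ε, hε, hb⟩ := Metric.eventually_nhds_iff_ball.1 hEG
  filter_upwards [Ioo_mem_nhdsGT hε] with ρ hρ
  gcongr ?_ / _
  refine measure_mono ?_
  rintro y ⟨hy, hy2⟩
  exact ⟨hb y (ball_subset_ball hρ.2.le hy2) hy, hy2⟩

lemma auxD0_union {n : ℕ} {E G : Set (Euc n)} {x : Euc n} (h : auxD0 E x) (h' : auxD0 G x) :
    auxD0 (E ∪ G) x := by
  have h2 := Tendsto.add h h'
  rw [add_zero] at h2
  refine tendsto_of_tendsto_of_tendsto_of_le_of_le tendsto_const_nhds h2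
    (fun _ => zero_le) (fun ρ => ?_)
  show volume ((E ∪ G) ∩ ball x ρ) / volume (ball x ρ) ≤ _
  rw [← ENNReal.add_div, union_inter_distrib_right]
  gcongr
  exact measure_union_le _ _

lemma aux_half {n : ℕ} (hn : 2 ≤ n) (x ν : Euc n) (hν : ‖ν‖ = 1) :
    ¬ auxD0 {y | ⟪y - x, ν⟫ < 0} x := by
  have : Nonempty (Fin n) := ⟨⟨0, by omega⟩⟩
  intro h
  have hc : (0:ℝ≥0∞) < ENNReal.ofReal ((1/2) ^ n) := by
    rw [ENNReal.ofReal_pos]; positivity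
  have h1 := (h.eventually (gt_mem_nhds hc)).and self_mem_nhdsWithin
  obtain ⟨ρ, h2, hρ⟩ := h1.exists
  have hsub : ball (x - (ρ/2) • ν) (1/2 * ρ) ⊆ {y | ⟪y - x, ν⟫ < 0} ∩ ball x ρ := by
    intro y hy
    rw [mem_ball, dist_eq_norm] at hy
    constructor
    · have e : y - x = (y - (x - (ρ/2) • ν)) - (ρ/2) • ν := by module
      have h3 := real_inner_le_norm (y - (x - (ρ/2) • ν)) ν
      rw [hν, mul_one] at h3
      show ⟪y - x, ν⟫ < 0
      rw [e, inner_sub_left, real_inner_smul_left, real_inner_self_eq_norm_sq, hν]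
      linarith
    · rw [mem_ball, dist_eq_norm]
      have e : y - x = (y - (x - (ρ/2) • ν)) - (ρ/2) • ν := by module
      rw [e]
      refine (norm_sub_le _ _).trans_lt ?_
      rw [norm_smul, hν, Real.norm_eq_abs, abs_of_pos (by positivity)]
      linarith
  have h3 := measure_mono (μ := volume) hsub
  rw [Measure.addHaar_ball_mul _ _ (by norm_num), finrank_euclideanSpace_fin,
      ← Measure.addHaar_ball_center _ x] at h3
  have hv0 : volume (ball x ρ) ≠ 0 := (measure_ball_pos _ _ hρ).ne'
  have hvt : volume (ball x ρ) ≠ ⊤ := measure_ball_lt_top.ne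
  rw [← ENNReal.le_div_iff_mul_le (Or.inl hv0) (Or.inl hvt)] at h3
  exact absurd h2 (not_lt.2 h3)

lemma aux_red_not0 {n : ℕ} (hn : 2 ≤ n) {F : Set (Euc n)} {x : Euc n} (h : x ∈ redBoundary F) :
    ¬ auxD0 F x ∧ ¬ auxD0 Fᶜ x := by
  obtain ⟨ν, hν, h1, h2⟩ := h
  constructor
  · intro h3
    refine aux_half hn x ν hν (auxD0_mono_ev (auxD0_union h3 h2) (Eventually.of_forall ?_))
    intro y hy
    by_cases hF : y ∈ F
    · exact Or.inl hF
    · exact Or.inr ⟨hF, hy⟩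
  · intro h3
    refine aux_half hn x (-ν) (by rwa [norm_neg])
      (auxD0_mono_ev (auxD0_union h3 h1) (Eventually.of_forall ?_))
    intro y hy
    have hy' : ⟪y - x, -ν⟫ < 0 := hy
    rw [inner_neg_right] at hy'
    by_cases hF : y ∈ F
    · exact Or.inr ⟨hF, by linarith⟩
    · exact Or.inl hF

lemma aux_dens1 {n : ℕ} {F : Set (Euc n)} (hF : MeasurableSet F) {x : Euc n}
    (h : DensityAt F x 1) : auxD0 Fᶜ x := by
  have h2 : Tendsto (fun ρ : ℝ => 1 - volume (F ∩ ball x ρ) / volume (ball x ρ))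
      (𝓝[>] (0:ℝ)) (𝓝 (1 - 1)) :=
    ENNReal.Tendsto.sub tendsto_const_nhds h (Or.inl ENNReal.one_ne_top)
  rw [tsub_self] at h2
  refine h2.congr' ?_
  filter_upwards [self_mem_nhdsWithin] with ρ hρ
  rw [mem_Ioi] at hρ
  have hv0 : volume (ball x ρ) ≠ 0 := (measure_ball_pos _ _ hρ).ne'
  have hvt : volume (ball x ρ) ≠ ⊤ := measure_ball_lt_top.ne
  have hft : volume (F ∩ ball x ρ) / volume (ball x ρ) ≠ ⊤ :=
    (ENNReal.div_lt_top (measure_ne_top_of_subset inter_subset_right hvt) hv0).ne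
  symm
  refine ENNReal.eq_sub_of_add_eq hft ?_
  have hadd := measure_inter_add_sdiff (μ := volume) (ball x ρ) hF
  rw [sdiff_eq] at hadd
  rw [← ENNReal.add_div, inter_comm, inter_comm F, add_comm, hadd, ENNReal.div_self hv0 hvt]

/-- If `A` has density zero at `‖x‖` then so does its radial preimage. -/
lemma aux_radial_D0 {n : ℕ} (hn : 2 ≤ n) (x : Euc n) (hx : x ≠ 0) {A : Set ℝ}
    (hA : MeasurableSet A) (h : RDensity0 A ‖x‖) : auxD0 {y : Euc n | ‖y‖ ∈ A} x := by
  have hx' : 0 < ‖x‖ := norm_pos_iff.2 hx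
  have h2 := ENNReal.Tendsto.const_mul h
    (Or.inr (by finiteness : (4 ^ (n - 1) * 3 ^ n : ℝ≥0∞) ≠ ⊤))
  rw [mul_zero] at h2
  refine tendsto_of_tendsto_of_tendsto_of_le_of_le' tendsto_const_nhds h2
    (Eventually.of_forall fun _ => zero_le) ?_
  filter_upwards [Ioo_mem_nhdsGT (half_pos hx')] with ρ hρ
  exact aux_upper hn x hx hA hρ.1 hρ.2

/-- Transfer of density zero from the space to the radii. -/
lemma aux_D0_radial {n : ℕ} (hn : 2 ≤ n) (x : Euc n) (hx : x ≠ 0) {A : Set ℝ}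
    (hA : MeasurableSet A) (V : Set (Euc n)) (κ : ℝ) (hκ : 0 < κ)
    (hV : ∀ ρ, 0 < ρ → ρ < ‖x‖/2 → ∃ z, ball z (κ * ρ) ⊆ ball x (ρ/4) ∩ {y | hatv y ∈ V})
    (h : auxD0 {y : Euc n | hatv y ∈ V ∧ ‖y‖ ∈ A} x) : RDensity0 A ‖x‖ := by
  have hx' : 0 < ‖x‖ := norm_pos_iff.2 hx
  have h2 := ENNReal.Tendsto.const_mul h
    (Or.inr (by finiteness : (4 ^ (n - 1) * ENNReal.ofReal (κ ^ n)⁻¹ : ℝ≥0∞) ≠ ⊤))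
  rw [mul_zero] at h2
  have hmap : Tendsto (fun ρ : ℝ => 2 * ρ) (𝓝[>] 0) (𝓝[>] 0) := by
    refine tendsto_nhdsWithin_iff.2 ⟨?_, ?_⟩
    · have : Tendsto (fun ρ : ℝ => 2 * ρ) (𝓝 0) (𝓝 (2 * 0)) :=
        (by fun_prop : Continuous fun ρ : ℝ => 2 * ρ).tendsto 0
      rw [mul_zero] at this
      exact this.mono_left nhdsWithin_le_nhds
    · filter_upwards [self_mem_nhdsWithin] with ρ hρ
      rw [mem_Ioi] at hρ ⊢
      positivity
  refine tendsto_of_tendsto_of_tendsto_of_le_of_le' tendsto_const_nhds (h2.comp hmap)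
    (Eventually.of_forall fun _ => zero_le) ?_
  filter_upwards [Ioo_mem_nhdsGT (by positivity : 0 < ‖x‖/4)] with ρ hρ
  have h3 := aux_lower hn x hx hA V κ hκ (ρ := 2 * ρ) (by linarith [hρ.1]) (by linarith [hρ.2])
    (hV _ (by linarith [hρ.1]) (by linarith [hρ.2]))
  rw [mul_div_cancel_left₀ ρ (two_ne_zero)] at h3
  exact h3

lemma aux_H1 {n : ℕ} (hn : 2 ≤ n) (x : Euc n) (hx : x ≠ 0) {S : Set (Euc n)} {T : Set ℝ}
    (hT : MeasurableSet T) (hT0 : volume T = 0)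
    (h : ∀ᶠ y in 𝓝 x, y ∈ S → ‖x‖ < ‖y‖ → ‖y‖ ∈ T) :
    auxD0 {y | y ∈ S ∧ 0 < ⟪y - x, hatv x⟫} x := by
  have h1 : RDensity0 T ‖x‖ := by
    have : ∀ ρ : ℝ, volume (T ∩ ball ‖x‖ ρ) / volume (ball ‖x‖ ρ) = 0 := by
      intro ρ
      rw [measure_mono_null inter_subset_left hT0, ENNReal.zero_div]
    unfold RDensity0
    simp only [this]
    exact tendsto_const_nhds
  refine auxD0_mono_ev (aux_radial_D0 hn x hx hT h1) ?_
  filter_upwards [h] with y hy hy2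
  refine hy hy2.1 ?_
  have h3 := hy2.2
  have h4 := real_inner_le_norm y (hatv x)
  rw [aux_norm_hat hx, mul_one] at h4
  rw [inner_sub_left] at h3
  have h5 : ⟪x, hatv x⟫ = ‖x‖ := by
    unfold hatv
    rw [real_inner_smul_right, real_inner_self_eq_norm_sq]
    have hx' : 0 < ‖x‖ := norm_pos_iff.2 hx
    field_simp
  linarith

lemma aux_H2 {n : ℕ} (hn : 2 ≤ n) (x : Euc n) (hx : x ≠ 0) {S : Set (Euc n)} {T : Set ℝ}
    (hT : MeasurableSet T) (hT0 : volume T = 0)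
    (h : ∀ᶠ y in 𝓝 x, y ∈ S → ‖y‖ < ‖x‖ → ‖y‖ ∈ T) :
    auxD0 {y | y ∈ S ∧ ⟪y - x, hatv x⟫ < 0} x := by
  have hx' : 0 < ‖x‖ := norm_pos_iff.2 hx
  have h5 : ⟪x, hatv x⟫ = ‖x‖ := by
    unfold hatv
    rw [real_inner_smul_right, real_inner_self_eq_norm_sq]
    field_simp
  have hlim : Tendsto (fun ρ : ℝ => (4 ^ (n - 1) * 3 ^ n : ℝ≥0∞) * ENNReal.ofReal (ρ / (4 * ‖x‖)))
      (𝓝[>] 0) (𝓝 0) := by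
    have h1 : Tendsto (fun ρ : ℝ => ENNReal.ofReal (ρ / (4 * ‖x‖))) (𝓝[>] 0) (𝓝 0) := by
      have : Tendsto (fun ρ : ℝ => ρ / (4 * ‖x‖)) (𝓝 0) (𝓝 (0 / (4 * ‖x‖))) :=
        (by fun_prop : Continuous fun ρ : ℝ => ρ / (4 * ‖x‖)).tendsto 0
      rw [zero_div] at this
      have h2 := ENNReal.tendsto_ofReal this
      rw [ENNReal.ofReal_zero] at h2
      exact h2.mono_left nhdsWithin_le_nhds
    have h2 := ENNReal.Tendsto.const_mul h1
      (Or.inr (by finiteness : (4 ^ (n - 1) * 3 ^ n : ℝ≥0∞) ≠ ⊤))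
    rwa [mul_zero] at h2
  refine tendsto_of_tendsto_of_tendsto_of_le_of_le' tendsto_const_nhds hlim
    (Eventually.of_forall fun _ => zero_le) ?_
  obtain ⟨ε, hε, hb⟩ := Metric.eventually_nhds_iff_ball.1 h
  filter_upwards [Ioo_mem_nhdsGT hε, Ioo_mem_nhdsGT (half_pos hx')] with ρ hρ hρ2
  have hA : MeasurableSet (T ∪ Icc ‖x‖ (‖x‖ + ρ^2/(2*‖x‖))) := hT.union measurableSet_Icc
  have hsub : {y | y ∈ S ∧ ⟪y - x, hatv x⟫ < 0} ∩ ball x ρ ⊆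
      {y : Euc n | ‖y‖ ∈ T ∪ Icc ‖x‖ (‖x‖ + ρ^2/(2*‖x‖))} ∩ ball x ρ := by
    rintro y ⟨⟨hyS, hy⟩, hyb⟩
    refine ⟨?_, hyb⟩
    rcases lt_or_ge ‖y‖ ‖x‖ with h1 | h1
    · exact Or.inl (hb y (ball_subset_ball hρ.2.le hyb) hyS h1)
    · refine Or.inr ⟨h1, ?_⟩
      rw [mem_ball, dist_eq_norm] at hyb
      have h2 : ‖y‖^2 = ‖x‖^2 + 2 * ⟪x, y - x⟫ + ‖y - x‖^2 := by
        have := norm_add_sq_real x (y - x)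
        rwa [add_sub_cancel] at this
      have h3 : ⟪x, y - x⟫ ≤ 0 := by
        rw [real_inner_comm, aux_eq_smul_hat hx, real_inner_smul_right, ← aux_eq_smul_hat hx]
        exact mul_nonpos_of_nonneg_of_nonpos hx'.le hy.le
      have h4 : ‖y - x‖^2 ≤ ρ^2 := by gcongr
      have h6 : ‖y‖^2 ≤ (‖x‖ + ρ^2/(2*‖x‖))^2 := by
        have : (‖x‖ + ρ^2/(2*‖x‖))^2 = ‖x‖^2 + ρ^2 + (ρ^2/(2*‖x‖))^2 := by
          field_simp; ring
        rw [this]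
        nlinarith [sq_nonneg (ρ^2/(2*‖x‖))]
      exact le_of_sq_le_sq h6 (by positivity)
  have hvol : volume ((T ∪ Icc ‖x‖ (‖x‖ + ρ^2/(2*‖x‖))) ∩ ball ‖x‖ ρ) / volume (ball ‖x‖ ρ)
      ≤ ENNReal.ofReal (ρ / (4 * ‖x‖)) := by
    have hw0 : volume (ball ‖x‖ ρ) ≠ 0 := (measure_ball_pos _ _ hρ.1).ne'
    have hwt : volume (ball ‖x‖ ρ) ≠ ⊤ := measure_ball_lt_top.ne
    rw [ENNReal.div_le_iff hw0 hwt, Real.volume_ball,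
      ← ENNReal.ofReal_mul (div_nonneg hρ.1.le (by positivity))]
    refine (measure_mono inter_subset_left).trans ((measure_union_le _ _).trans ?_)
    rw [hT0, zero_add, Real.volume_Icc]
    refine ENNReal.ofReal_le_ofReal (le_of_eq ?_)
    field_simp
    ring
  calc _ ≤ volume ({y : Euc n | ‖y‖ ∈ T ∪ Icc ‖x‖ (‖x‖ + ρ^2/(2*‖x‖))} ∩ ball x ρ)
        / volume (ball x ρ) := by gcongr
    _ ≤ _ := aux_upper hn x hx hA hρ.1 hρ2.2
    _ ≤ _ := by gcongr

/-! ### One-dimensional dichotomy -/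

lemma aux_R_small {A : Set ℝ} {s : ℝ} (h : RDensity0 A s) {ε : ℝ} (hε : 0 < ε) :
    ∃ δ > 0, ∀ y, |y - s| < δ → volume (A ∩ uIoc s y) ≤ ENNReal.ofReal (ε * |y - s|) := by
  have h1 := h.eventually (gt_mem_nhds (by rw [ENNReal.ofReal_pos]; positivity :
    (0:ℝ≥0∞) < ENNReal.ofReal (ε/4)))
  obtain ⟨δ, hδ, h2⟩ := (mem_nhdsGT_iff_exists_Ioo_subset).1 h1
  rw [mem_Ioi] at hδ
  refine ⟨δ/2, by positivity, fun y hy => ?_⟩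
  rcases eq_or_ne y s with rfl | hys
  · simp
  have hpos : 0 < |y - s| := abs_pos.2 (sub_ne_zero.2 hys)
  have h3 : volume (A ∩ ball s (2 * |y - s|)) / volume (ball s (2 * |y - s|)) <
      ENNReal.ofReal (ε/4) := h2 ⟨by positivity, by linarith⟩
  have hw0 : volume (ball s (2 * |y - s|)) ≠ 0 := (measure_ball_pos _ _ (by positivity)).ne'
  have hwt : volume (ball s (2 * |y - s|)) ≠ ⊤ := measure_ball_lt_top.ne
  have h4 := (ENNReal.div_le_iff hw0 hwt).1 h3.le
  rw [Real.volume_ball, ← ENNReal.ofReal_mul (by positivity)] at h4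
  refine (measure_mono ?_).trans (h4.trans (le_of_eq ?_))
  · refine inter_subset_inter_right _ fun t ht => ?_
    have : |t - s| ≤ |y - s| := abs_sub_left_of_mem_uIcc (uIoc_subset_uIcc ht)
    rw [mem_ball, Real.dist_eq]
    linarith
  · congr 1; ring

lemma aux_hasDeriv0 {A : Set ℝ} (hA : MeasurableSet A) {c s : ℝ} (h : RDensity0 A s) :
    HasDerivAt (fun y => ∫ t in c..y, A.indicator (fun _ => (1:ℝ)) t) 0 s := by
  have hint : ∀ a b : ℝ, IntervalIntegrable (A.indicator (fun _ => (1:ℝ))) volume a b := by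
    intro a b
    have := intervalIntegrable_const (c := (1:ℝ)) (μ := volume) (a := a) (b := b)
    exact ⟨this.1.indicator hA, this.2.indicator hA⟩
  rw [hasDerivAt_iff_isLittleO]
  refine Asymptotics.isLittleO_iff.2 fun ε hε => ?_
  obtain ⟨δ, hδ, h1⟩ := aux_R_small h hε
  filter_upwards [Metric.ball_mem_nhds s hδ] with y hy
  rw [mem_ball, Real.dist_eq] at hy
  rw [smul_zero, sub_zero, intervalIntegral.integral_interval_sub_left (hint _ _) (hint _ _),
    Real.norm_eq_abs (y - s)]
  rw [intervalIntegral.norm_intervalIntegral_eq, integral_indicator hA, setIntegral_const,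
    smul_eq_mul, mul_one, Measure.real, Measure.restrict_apply hA, Real.norm_eq_abs,
    abs_of_nonneg ENNReal.toReal_nonneg]
  exact ENNReal.toReal_le_of_le_ofReal (by positivity) (h1 y hy)

lemma aux_hasDeriv1 {A : Set ℝ} (hA : MeasurableSet A) {c s : ℝ} (h : RDensity0 Aᶜ s) :
    HasDerivAt (fun y => ∫ t in c..y, A.indicator (fun _ => (1:ℝ)) t) 1 s := by
  have hint : ∀ B : Set ℝ, MeasurableSet B → ∀ a b : ℝ,
      IntervalIntegrable (B.indicator (fun _ => (1:ℝ))) volume a b := by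
    intro B hB a b
    have := intervalIntegrable_const (c := (1:ℝ)) (μ := volume) (a := a) (b := b)
    exact ⟨this.1.indicator hB, this.2.indicator hB⟩
  have h1 := aux_hasDeriv0 hA.compl (c := c) h
  have h2 := ((hasDerivAt_id s).sub_const c).sub h1
  rw [sub_zero] at h2
  refine h2.congr_of_eventuallyEq (Eventually.of_forall fun y => ?_)
  have e : A.indicator (fun _ => (1:ℝ)) = fun t => 1 - Aᶜ.indicator (fun _ => (1:ℝ)) t := by
    ext t
    by_cases ht : t ∈ A <;> simp [ht]
  show (∫ t in c..y, A.indicator (fun _ => (1:ℝ)) t) = (y - c) - _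
  rw [e, intervalIntegral.integral_sub intervalIntegrable_const (hint _ hA.compl _ _)]
  simp

lemma aux_null_of_deriv0 {A : Set ℝ} (hA : MeasurableSet A) {a b : ℝ}
    (h : ∀ s ∈ Ioo a b, RDensity0 A s) : volume (A ∩ Ioo a b) = 0 := by
  by_contra hne
  have h1 := Besicovitch.ae_tendsto_measure_inter_div volume (A ∩ Ioo a b)
  have h2 : (ae (volume.restrict (A ∩ Ioo a b))).NeBot := by
    rw [ae_neBot]
    intro h3
    rw [Measure.restrict_eq_zero] at h3
    exact hne h3
  obtain ⟨s, h3, h4⟩ := (h1.and (ae_restrict_mem (hA.inter measurableSet_Ioo))).exists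
  have h5 := h s h4.2
  have h6 := h3.congr' (f₂ := fun ρ => volume ((A ∩ Ioo a b) ∩ ball s ρ) / volume (ball s ρ)) ?_
  · have h7 : Tendsto (fun ρ => volume ((A ∩ Ioo a b) ∩ ball s ρ) / volume (ball s ρ))
        (𝓝[>] 0) (𝓝 0) := by
      refine tendsto_of_tendsto_of_tendsto_of_le_of_le tendsto_const_nhds h5
        (fun _ => zero_le) (fun ρ => ?_)
      show _ / _ ≤ _ / _
      gcongr
      exact inter_subset_left
    exact zero_ne_one (tendsto_nhds_unique h7 h6)
  · refine Eventually.of_forall fun ρ => ?_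
    have : volume (closedBall s ρ) = volume (ball s ρ) := by
      rw [Real.volume_ball, Real.volume_closedBall]
    have h8 : (ball s ρ : Set ℝ) =ᵐ[volume] closedBall s ρ := by
      rw [Real.ball_eq_Ioo, Real.closedBall_eq_Icc]
      exact Ioo_ae_eq_Icc
    simp only [this]
    congr 1
    exact measure_congr ((ae_eq_refl _).inter h8.symm)

lemma aux_dichotomy {A : Set ℝ} (hA : MeasurableSet A) {a b : ℝ}
    (h : ∀ s ∈ Ioo a b, RDensity0 A s ∨ RDensity0 Aᶜ s) :
    volume (A ∩ Ioo a b) = 0 ∨ volume (Aᶜ ∩ Ioo a b) = 0 := by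
  classical
  have key : (∀ s ∈ Ioo a b, RDensity0 A s) ∨ (∀ s ∈ Ioo a b, RDensity0 Aᶜ s) := by
    by_contra! hcon
    obtain ⟨⟨s, hs, hs'⟩, ⟨t, ht, ht'⟩⟩ := hcon
    set f' : ℝ → ℝ := fun s => if RDensity0 A s then 0 else 1 with hf'
    have hd : ∀ u ∈ Ioo a b,
        HasDerivAt (fun y => ∫ t in a..y, A.indicator (fun _ => (1:ℝ)) t) (f' u) u := by
      intro u hu
      by_cases h1 : RDensity0 A u
      · simp only [hf', h1, if_true]
        exact aux_hasDeriv0 hA h1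
      · simp only [hf', h1, if_false]
        exact aux_hasDeriv1 hA ((h u hu).resolve_left h1)
    have hs1 : f' s = 1 := by simp only [hf', hs', if_false]
    have ht1 : f' t = 0 := by simp only [hf', (h t ht).resolve_right ht', if_true]
    have hn : ∀ u, f' u ≠ 1/2 := by
      intro u
      simp only [hf']
      split_ifs <;> norm_num
    rcases le_total s t with hst | hst
    · obtain ⟨u, -, hu⟩ := exists_hasDerivWithinAt_eq_of_lt_of_gt (m := 1/2) hst
        (fun x hx => (hd x ⟨hs.1.trans_le hx.1, hx.2.trans_lt ht.2⟩).hasDerivWithinAt)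
        (by rw [hs1]; norm_num) (by rw [ht1]; norm_num)
      exact hn u hu
    · obtain ⟨u, -, hu⟩ := exists_hasDerivWithinAt_eq_of_gt_of_lt (m := 1/2) hst
        (fun x hx => (hd x ⟨ht.1.trans_le hx.1, hx.2.trans_lt hs.2⟩).hasDerivWithinAt)
        (by rw [ht1]; norm_num) (by rw [hs1]; norm_num)
      exact hn u hu
  rcases key with h1 | h1
  · exact Or.inl (aux_null_of_deriv0 hA h1)
  · exact Or.inr (aux_null_of_deriv0 hA.compl h1)

/-! ### Angles -/

lemma aux_inner_abs {n : ℕ} {p : Euc n} (hp : ‖p‖ = 1) (x : Euc n) : |⟪hatv x, p⟫| ≤ 1 := by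
  refine (abs_real_inner_le_norm _ _).trans ?_
  rw [hp, mul_one]
  by_cases hx : x = 0
  · simp [hatv, hx]
  · rw [aux_norm_hat hx]

lemma aux_inner_hat {n : ℕ} {p : Euc n} {x : Euc n} (hx : x ≠ 0) :
    ⟪x, p⟫ = ‖x‖ * ⟪hatv x, p⟫ := by
  conv_lhs => rw [aux_eq_smul_hat hx, real_inner_smul_left]

lemma aux_cap_ball {n : ℕ} {p : Euc n} (hp : ‖p‖ = 1) {x : Euc n} (hx : x ≠ 0) {c : ℝ}
    (hc : ⟪hatv x, p⟫ = c) (hc1 : c ^ 2 < 1) {σ : ℝ} (hσ : σ = 1 ∨ σ = -1)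
    {ρ : ℝ} (hρ : 0 < ρ) (hρx : ρ < ‖x‖ / 2) :
    ball (x + (σ * (ρ / 8)) • (p - c • hatv x)) ((1 - c ^ 2) / 32 * ρ) ⊆
      ball x (ρ/4) ∩ {y | 0 < σ * (⟪hatv y, p⟫ - c)} := by
  have hx' : 0 < ‖x‖ := norm_pos_iff.2 hx
  set w := p - c • hatv x with hw
  set z := x + (σ * (ρ / 8)) • w with hz
  have hσ2 : σ * σ = 1 := by rcases hσ with rfl | rfl <;> norm_num
  have hσa : |σ| = 1 := by rcases hσ with rfl | rfl <;> norm_num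
  have hh : ⟪hatv x, hatv x⟫ = 1 := by rw [real_inner_self_eq_norm_sq, aux_norm_hat hx]; norm_num
  have hpp : ⟪p, p⟫ = 1 := by rw [real_inner_self_eq_norm_sq, hp]; norm_num
  have hww : ⟪w, w⟫ = 1 - c ^ 2 := by
    rw [hw, inner_sub_left, inner_sub_right, inner_sub_right, real_inner_smul_left,
      real_inner_smul_right, real_inner_smul_left, real_inner_smul_right, hpp, hh, hc,
      real_inner_comm, hc]
    ring
  have hwp : ⟪w, p⟫ = 1 - c ^ 2 := by
    rw [hw, inner_sub_left, real_inner_smul_left, hpp, hc]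
    ring
  have hwx : ⟪w, hatv x⟫ = 0 := by
    rw [hw, inner_sub_left, real_inner_smul_left, hh, real_inner_comm, hc]
    ring
  have hxw : ⟪x, w⟫ = 0 := by
    rw [aux_inner_hat hx, real_inner_comm, hwx, mul_zero]
  have hw1 : ‖w‖ ≤ 1 := by
    have : ‖w‖ ^ 2 ≤ 1 := by rw [← real_inner_self_eq_norm_sq, hww]; nlinarith [sq_nonneg c]
    nlinarith [norm_nonneg w]
  have hzn : ‖z‖ ^ 2 = ‖x‖ ^ 2 + (ρ/8) ^ 2 * (1 - c ^ 2) := by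
    rw [hz, norm_add_sq_real, real_inner_smul_right, hxw, norm_smul, mul_pow,
      ← real_inner_self_eq_norm_sq w, hww, Real.norm_eq_abs, sq_abs, mul_pow, sq σ, hσ2]
    ring
  have hz1 : ‖x‖ ≤ ‖z‖ := le_of_sq_le_sq (by rw [hzn]; nlinarith [sq_nonneg (ρ/8)]) (norm_nonneg _)
  have hz2 : ‖z‖ - ‖x‖ ≤ (ρ/8) * (1 - c ^ 2) / 32 := by
    have h1 : (‖z‖ - ‖x‖) * (2 * ‖x‖) ≤ (ρ/8) ^ 2 * (1 - c ^ 2) := by nlinarith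
    have h2 : (ρ/8) ^ 2 * (1 - c ^ 2) ≤ ((ρ/8) * (1 - c ^ 2) / 32) * (2 * ‖x‖) := by
      have : 0 < ρ/8 * (1 - c ^ 2) := by
        have : 0 < 1 - c ^ 2 := by linarith
        positivity
      nlinarith
    exact le_of_mul_le_mul_right (h1.trans h2) (by positivity)
  have hc2 : |c| ≤ 1 := by
    rw [← hc]; exact aux_inner_abs hp x
  intro y hy
  rw [mem_ball, dist_eq_norm] at hy
  have hyx : ‖y - x‖ < ρ/4 := by
    have e : y - x = (y - z) + (σ * (ρ / 8)) • w := by rw [hz]; module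
    have : ‖y - x‖ ≤ ‖y - z‖ + ρ/8 * ‖w‖ := by
      rw [e]
      refine (norm_add_le _ _).trans (le_of_eq ?_)
      rw [norm_smul, Real.norm_eq_abs, abs_mul, hσa, abs_of_pos (by positivity), one_mul]
    nlinarith [sq_nonneg c]
  refine ⟨by rw [mem_ball, dist_eq_norm]; exact hyx, ?_⟩
  have hy0 : y ≠ 0 := by
    rintro rfl
    rw [zero_sub, norm_neg] at hyx
    linarith
  have hy' : 0 < ‖y‖ := norm_pos_iff.2 hy0
  have hyp : ⟪y, p⟫ = ‖y‖ * ⟪hatv y, p⟫ := aux_inner_hat hy0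
  have hyz : ⟪y, p⟫ = ⟪y - z, p⟫ + ‖x‖ * c + σ * (ρ/8) * (1 - c^2) := by
    have e : y = (y - z) + x + (σ * (ρ / 8)) • w := by rw [hz]; module
    conv_lhs => rw [e]
    rw [inner_add_left, inner_add_left, real_inner_smul_left, hwp, aux_inner_hat hx, hc]
  have h1 : |⟪y - z, p⟫| ≤ ‖y - z‖ := by
    have := abs_real_inner_le_norm (y - z) p
    rwa [hp, mul_one] at this
  have h2 : |‖y‖ - ‖z‖| ≤ ‖y - z‖ := abs_norm_sub_norm_le y z
  have h3 : |c * (‖y‖ - ‖x‖)| ≤ ‖y - z‖ + (ρ/8) * (1 - c ^ 2) / 32 := by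
    rw [abs_mul]
    have : |‖y‖ - ‖x‖| ≤ ‖y - z‖ + (ρ/8) * (1 - c ^ 2) / 32 := by
      have e : ‖y‖ - ‖x‖ = (‖y‖ - ‖z‖) + (‖z‖ - ‖x‖) := by ring
      rw [e]
      refine (abs_add_le _ _).trans ?_
      rw [abs_of_nonneg (sub_nonneg.2 hz1)]
      linarith
    nlinarith [abs_nonneg c, abs_nonneg (‖y‖ - ‖x‖)]
  show 0 < σ * (⟪hatv y, p⟫ - c)
  have h4 : ‖y‖ * (σ * (⟪hatv y, p⟫ - c)) =
      σ * ⟪y - z, p⟫ - σ * (c * (‖y‖ - ‖x‖)) + (ρ/8) * (1 - c^2) := by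
    have : ‖y‖ * (σ * (⟪hatv y, p⟫ - c)) = σ * (‖y‖ * ⟪hatv y, p⟫) - σ * c * ‖y‖ := by ring
    rw [this, ← hyp, hyz]
    linear_combination (ρ/8) * (1 - c^2) * hσ2
  have h5 : |σ * ⟪y - z, p⟫| ≤ ‖y - z‖ := by rw [abs_mul, hσa, one_mul]; exact h1
  have h6 : |σ * (c * (‖y‖ - ‖x‖))| ≤ ‖y - z‖ + (ρ/8) * (1 - c ^ 2) / 32 := by
    rw [abs_mul, hσa, one_mul]; exact h3
  have h7 : 0 < ‖y‖ * (σ * (⟪hatv y, p⟫ - c)) := by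
    rw [h4]
    have := abs_le.1 h5
    have := abs_le.1 h6
    have : 0 < ρ * (1 - c ^ 2) := mul_pos hρ (by linarith)
    linarith
  exact (mul_pos_iff_of_pos_left hy').1 h7

lemma aux_meas_F {n : ℕ} {α : ℝ → ℝ} (hα : Measurable α) (p : Euc n) :
    MeasurableSet (sphSymm n α p) := by
  have h1 : MeasurableSet {x : Euc n | x ≠ 0} := (measurableSet_singleton (0 : Euc n)).compl
  have h2 : MeasurableSet {x : Euc n | Real.arccos ⟪hatv x, p⟫ < α ‖x‖} := by
    refine measurableSet_lt ?_ (hα.comp measurable_norm)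
    refine Real.continuous_arccos.measurable.comp ?_
    unfold hatv
    refine Measurable.inner ?_ measurable_const
    exact (measurable_norm.inv).smul measurable_id
  exact h1.inter h2

lemma aux_ess {n : ℕ} (hn : 2 ≤ n) {α : ℝ → ℝ} (hα : Measurable α) {p : Euc n} (hp : ‖p‖ = 1)
    {x : Euc n} (hx : x ≠ 0) {θ : ℝ} (hθ : Real.arccos ⟪hatv x, p⟫ = θ) (h0 : 0 < θ)
    (h1 : θ < Real.pi) (hA : ¬ RDensity0 {t | θ < α t} ‖x‖) (hA' : ¬ RDensity0 {t | θ < α t}ᶜ ‖x‖) :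
    x ∈ essBoundary (sphSymm n α p) := by
  have hmA : MeasurableSet {t | θ < α t} := measurableSet_lt measurable_const hα
  set c := ⟪hatv x, p⟫ with hc
  have hcb : c < 1 := by rw [← hθ, Real.arccos_pos] at h0; exact h0
  have hcb' : -1 < c := by
    by_contra! h
    rw [← hθ, Real.arccos_of_le_neg_one h] at h1
    exact lt_irrefl _ h1
  have hc1 : c ^ 2 < 1 := by nlinarith
  have hne : ∀ᶠ y in 𝓝 x, y ≠ 0 := isOpen_ne.mem_nhds hx
  constructor
  · intro hd
    refine hA (aux_D0_radial hn x hx hmA {u | 0 < (1:ℝ) * (⟪u, p⟫ - c)} ((1 - c ^ 2) / 32)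
      (by linarith) (fun ρ hρ hρx => ⟨_, aux_cap_ball hp hx rfl hc1 (Or.inl rfl) hρ hρx⟩) ?_)
    refine auxD0_mono_ev hd ?_
    filter_upwards [hne] with y hy
    rintro ⟨hy1, hy2⟩
    have hy1' : 0 < (1:ℝ) * (⟪hatv y, p⟫ - c) := hy1
    have hy2' : θ < α ‖y‖ := hy2
    refine ⟨hy, lt_trans ?_ hy2'⟩
    rw [← hθ]
    exact Real.arccos_lt_arccos hcb'.le (by linarith) (abs_le.1 (aux_inner_abs hp y)).2
  · intro hd
    have hd' := aux_dens1 (aux_meas_F hα p) hd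
    refine hA' (aux_D0_radial hn x hx hmA.compl {u | 0 < (-1:ℝ) * (⟪u, p⟫ - c)} ((1 - c ^ 2) / 32)
      (by linarith) (fun ρ hρ hρx => ⟨_, aux_cap_ball hp hx rfl hc1 (Or.inr rfl) hρ hρx⟩) ?_)
    refine auxD0_mono_ev hd' ?_
    filter_upwards [hne] with y hy
    rintro ⟨hy1, hy2⟩
    have hy1' : 0 < (-1:ℝ) * (⟪hatv y, p⟫ - c) := hy1
    have hy2' : ¬ θ < α ‖y‖ := hy2
    rintro ⟨-, hy3⟩
    refine hy2' (lt_of_le_of_lt ?_ hy3)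
    rw [← hθ]
    exact Real.arccos_le_arccos (by linarith)

/-! ### Hausdorff measure -/

lemma aux_latitude {n : ℕ} (hn : 2 ≤ n) {p : Euc n} (hp : ‖p‖ = 1) {r : ℝ} (hr : 0 < r) (θ : ℝ) :
    μH[(n : ℝ) - 1] {x : Euc n | ‖x‖ = r ∧ Real.arccos ⟪hatv x, p⟫ = θ} = 0 := by
  obtain ⟨m, rfl⟩ : ∃ m, n = m + 1 := ⟨n - 1, by omega⟩
  have hp0 : p ≠ 0 := by rintro rfl; simp at hp
  have : Fact (Module.finrank ℝ (Euc (m+1)) = m + 1) := ⟨finrank_euclideanSpace_fin⟩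
  set W := (ℝ ∙ p)ᗮ with hW
  have hfr : Module.finrank ℝ W = m := Submodule.finrank_orthogonal_span_singleton hp0
  have : Nontrivial W := Module.nontrivial_of_finrank_pos (R := ℝ) (by rw [hfr]; omega)
  set c := r * Real.cos θ with hc
  have hiso : Isometry (fun w : W => (w : Euc (m+1)) + c • p) := by
    refine Isometry.of_dist_eq fun a b => ?_
    rw [dist_add_right]; rfl
  have hd : ((m + 1 : ℕ) : ℝ) - 1 = (Module.finrank ℝ W : ℝ) := by rw [hfr]; push_cast; ring
  rw [hd]
  have hs : μH[(Module.finrank ℝ W : ℝ)] (sphere (0 : W) (√(r^2 - c^2))) = 0 :=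
    Measure.addHaar_sphere _ _ _
  refine measure_mono_null (t := (fun w : W => (w : Euc (m+1)) + c • p) ''
    (sphere (0 : W) (√(r^2 - c^2)))) ?_ ?_
  · rintro x ⟨hx, hxθ⟩
    have hx0 : x ≠ 0 := by rintro rfl; simp at hx; linarith
    have hxp : ⟪x, p⟫ = c := by
      rw [aux_inner_hat hx0, hx, hc, ← hxθ, Real.cos_arccos]
      · exact (abs_le.1 (aux_inner_abs hp x)).1
      · exact (abs_le.1 (aux_inner_abs hp x)).2
    have hmem : x - c • p ∈ W := by
      rw [hW, Submodule.mem_orthogonal_singleton_iff_inner_left, inner_sub_left,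
        real_inner_smul_left, real_inner_self_eq_norm_sq, hp, hxp]
      ring
    refine ⟨⟨x - c • p, hmem⟩, ?_, by simp⟩
    rw [mem_sphere_zero_iff_norm, Submodule.coe_norm, Submodule.coe_mk]
    rw [← Real.sqrt_sq (norm_nonneg (x - c • p)), norm_sub_sq_real, real_inner_smul_right, hxp,
      norm_smul, hp, hx, mul_one, Real.norm_eq_abs, sq_abs]
    congr 1; ring
  · rw [hiso.hausdorffMeasure_image (Or.inl (by positivity)), hs]

/-- angles whose superlevel set has no essential boundary points near `r` -/
def auxGood (α : ℝ → ℝ) (r θ : ℝ) : Prop :=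
  ∃ δ > 0, ∀ s, 0 < |s - r| → |s - r| < δ →
    RDensity0 {t | θ < α t} s ∨ RDensity0 {t | θ < α t}ᶜ s

lemma aux_bad_null {n : ℕ} (hn : 2 ≤ n) {α : ℝ → ℝ} (hα : Measurable α) {p : Euc n} (hp : ‖p‖ = 1)
    (hF : perim (sphSymm n α p) univ < ⊤) {r : ℝ} (hr : 0 < r) :
    μH[(n : ℝ) - 1] {x : Euc n | ‖x‖ = r ∧ 0 < Real.arccos ⟪hatv x, p⟫ ∧
      Real.arccos ⟪hatv x, p⟫ < Real.pi ∧ ¬ auxGood α r (Real.arccos ⟪hatv x, p⟫)} = 0 := by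
  have hd : (0:ℝ) ≤ (n : ℝ) - 1 := by
    have : (2:ℝ) ≤ n := by exact_mod_cast hn
    linarith
  set μ : Measure (Euc n) := μH[(n : ℝ) - 1] with hμ
  set δ : ℕ → ℝ := fun i => r / 2 / ((i : ℝ) + 1) with hδ
  have hδpos : ∀ i, 0 < δ i := fun i => by simp only [hδ]; positivity
  have hδanti : Antitone δ := by
    intro i j hij
    simp only [hδ]
    have : (i:ℝ) ≤ j := by exact_mod_cast hij
    gcongr
  have hδlim : Tendsto δ atTop (𝓝 0) := by
    have := (tendsto_one_div_add_atTop_nhds_zero_nat (𝕜 := ℝ)).const_mul (r/2)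
    rw [mul_zero] at this
    refine this.congr fun i => ?_
    simp only [hδ]; ring
  set J : ℕ → Set ℝ := fun i => {s | δ (i+1) ≤ |s - r| ∧ |s - r| < δ i} with hJ
  have hJm : ∀ i, MeasurableSet (J i) := by
    intro i
    have hm : Measurable fun s : ℝ => |s - r| := by fun_prop
    exact (measurableSet_le measurable_const hm).inter (measurableSet_lt hm measurable_const)
  set E := essBoundary (sphSymm n α p) with hE
  have hEfin : μ E < ⊤ := by
    have : perim (sphSymm n α p) univ = μ E := by rw [perim, inter_univ]
    rwa [this] at hF
  set N : ℕ → Set (Euc n) := fun i => {y | ‖y‖ ∈ J i} with hN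
  have hNm : ∀ i, MeasurableSet (N i) := fun i => measurable_norm (hJm i)
  have hNd : Pairwise (Function.onFun Disjoint N) := by
    have key : ∀ i j, i < j → Disjoint (N i) (N j) := by
      intro i j hij
      rw [Set.disjoint_left]
      rintro y ⟨h1, -⟩ ⟨-, h2⟩
      have := hδanti (Nat.succ_le_of_lt hij)
      simp only [Nat.succ_eq_add_one] at this
      linarith
    intro i j hij
    rcases lt_or_gt_of_ne hij with h | h
    · exact key i j h
    · exact (key j i h).symm
  have hsum : ∑' i, μ (N i ∩ E) ≤ μ E := by
    have := tsum_measure_le_measure_univ (μ := μ.restrict E)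
      (fun i => (hNm i).nullMeasurableSet) (fun i j hij => (hNd hij).aedisjoint)
    rw [Measure.restrict_apply_univ] at this
    simpa only [Measure.restrict_apply (hNm _)] using this
  set D : ℕ → Set (Euc n) := fun i => {x | ‖x‖ = r ∧ 0 < Real.arccos ⟪hatv x, p⟫ ∧
      Real.arccos ⟪hatv x, p⟫ < Real.pi ∧ ∃ s ∈ J i,
        ¬ RDensity0 {t | Real.arccos ⟪hatv x, p⟫ < α t} s ∧
        ¬ RDensity0 {t | Real.arccos ⟪hatv x, p⟫ < α t}ᶜ s} with hD
  have hlip : LipschitzOnWith 4 (fun y : Euc n => r • hatv y) {y : Euc n | r/2 ≤ ‖y‖} := by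
    refine LipschitzOnWith.of_dist_le_mul fun x hx y hy => ?_
    have hx1 : r/2 ≤ ‖x‖ := hx
    have hy1 : r/2 ≤ ‖y‖ := hy
    have hx0 : x ≠ 0 := by rintro rfl; rw [norm_zero] at hx1; linarith
    have hy0 : y ≠ 0 := by rintro rfl; rw [norm_zero] at hy1; linarith
    rw [dist_eq_norm, dist_eq_norm, ← smul_sub, norm_smul, Real.norm_eq_abs, abs_of_pos hr]
    have h1 := aux_dist_hat hy0 hx0
    calc r * ‖hatv x - hatv y‖ ≤ r * (2 * ‖x - y‖ / ‖y‖) := by gcongr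
      _ ≤ r * (2 * ‖x - y‖ / (r/2)) := by gcongr
      _ = _ := by
        rw [show ((4:ℝ≥0):ℝ) = 4 from rfl]
        field_simp
        ring
  have hDle : ∀ i, μ (D i) ≤ ((4:ℝ≥0):ℝ≥0∞) ^ ((n:ℝ) - 1) * μ (N i ∩ E) := by
    intro i
    have hsub : N i ∩ E ⊆ {y : Euc n | r/2 ≤ ‖y‖} := by
      rintro y ⟨⟨-, h2⟩, -⟩
      have h3 : δ i ≤ r/2 := by
        have := hδanti (Nat.zero_le i)
        simpa [hδ] using this
      have := (abs_lt.1 h2).1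
      show r/2 ≤ ‖y‖
      linarith
    refine le_trans (measure_mono ?_) ((hlip.mono hsub).hausdorffMeasure_image_le hd)
    rintro x ⟨hx, h0, h1, s, hs, hs1, hs2⟩
    have hx0 : x ≠ 0 := by rintro rfl; rw [norm_zero] at hx; linarith
    have hspos : 0 < s := by
      have h3 : δ i ≤ r/2 := by
        have := hδanti (Nat.zero_le i)
        simpa [hδ] using this
      have := (abs_lt.1 hs.2).1
      linarith
    have hnorm : ‖s • hatv x‖ = s := by
      rw [norm_smul, aux_norm_hat hx0, mul_one, Real.norm_eq_abs, abs_of_pos hspos]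
    have hhat : hatv (s • hatv x) = hatv x := by
      conv_lhs => rw [hatv, hnorm, smul_smul, inv_mul_cancel₀ hspos.ne', one_smul]
    refine ⟨s • hatv x, ⟨?_, ?_⟩, ?_⟩
    · show ‖s • hatv x‖ ∈ J i
      rwa [hnorm]
    · refine aux_ess hn hα hp ?_ (by rw [hhat]) h0 h1 (by rwa [hnorm]) (by rwa [hnorm])
      rw [← norm_pos_iff, hnorm]; exact hspos
    · show r • hatv (s • hatv x) = x
      rw [hhat, ← hx, ← aux_eq_smul_hat hx0]
  have hDsum : ∑' i, μ (D i) ≠ ⊤ := by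
    refine ne_top_of_le_ne_top ?_ (ENNReal.tsum_le_tsum hDle)
    rw [ENNReal.tsum_mul_left]
    refine ENNReal.mul_ne_top ?_ (ne_top_of_le_ne_top hEfin.ne hsum)
    exact ENNReal.rpow_ne_top_of_nonneg hd ENNReal.coe_ne_top
  have hBC := measure_setOfPred_frequently_eq_zero (μ := μ) (p := fun i x => x ∈ D i) hDsum
  refine measure_mono_null ?_ hBC
  rintro x ⟨hx, h0, h1, hbad⟩
  show ∃ᶠ i in atTop, x ∈ D i
  by_contra hcon
  rw [not_frequently, eventually_atTop] at hcon
  obtain ⟨i0, hi0⟩ := hcon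
  refine hbad ⟨δ i0, hδpos i0, fun s hs1 hs2 => ?_⟩
  by_contra! hs
  classical
  have hex : ∃ k, δ k ≤ |s - r| := (hδlim.eventually (ge_mem_nhds hs1)).exists
  have hk := Nat.find_spec hex
  have hk0 : i0 < Nat.find hex := by
    by_contra! h
    have := hδanti h
    linarith
  obtain ⟨k, hk'⟩ : ∃ k, Nat.find hex = k + 1 := ⟨Nat.find hex - 1, by omega⟩
  have hkm : |s - r| < δ k := not_le.1 (Nat.find_min hex (by omega))
  rw [hk'] at hk
  exact hi0 k (by omega) ⟨hx, h0, h1, s, ⟨hk, hkm⟩, hs.1, hs.2⟩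


/-! ### Final assembly -/

lemma aux_rd_mono {S T : Set ℝ} {x : ℝ} (h : RDensity0 T x) (hST : S ⊆ T) : RDensity0 S x := by
  refine tendsto_of_tendsto_of_tendsto_of_le_of_le tendsto_const_nhds h
    (fun _ => zero_le) (fun ρ => ?_)
  show volume (S ∩ ball x ρ) / volume (ball x ρ) ≤ volume (T ∩ ball x ρ) / volume (ball x ρ)
  gcongr

lemma aux_rd_null {S : Set ℝ} {r δ : ℝ} (hδ : 0 < δ) (h1 : volume (S ∩ Ioo r (r + δ)) = 0)
    (h2 : volume (S ∩ Ioo (r - δ) r) = 0) : RDensity0 S r := by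
  refine tendsto_const_nhds.congr' ?_
  filter_upwards [Ioo_mem_nhdsGT hδ] with ρ hρ
  have : volume (S ∩ ball r ρ) = 0 := by
    refine measure_mono_null ?_
      (measure_union_null (measure_union_null h1 h2) (Real.volume_singleton (a := r)))
    rintro y ⟨hy, hy2⟩
    rw [mem_ball, Real.dist_eq, abs_lt] at hy2
    have := hρ.2
    rcases lt_trichotomy y r with h | h | h
    · exact Or.inl (Or.inr ⟨hy, by constructor <;> linarith⟩)
    · exact Or.inr h
    · exact Or.inl (Or.inl ⟨hy, by constructor <;> linarith⟩)
  rw [this, ENNReal.zero_div]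

lemma aux_rd_univ (x : ℝ) : ¬ RDensity0 univ x := by
  intro h
  have h2 : Tendsto (fun ρ : ℝ => volume (univ ∩ ball x ρ) / volume (ball x ρ)) (𝓝[>] (0:ℝ))
      (𝓝 1) := by
    refine tendsto_const_nhds.congr' ?_
    filter_upwards [self_mem_nhdsWithin] with ρ hρ
    have hρ' : (0:ℝ) < ρ := hρ
    rw [univ_inter, ENNReal.div_self]
    · exact (measure_ball_pos volume x hρ').ne'
    · exact measure_ball_lt_top.ne
  exact zero_ne_one (tendsto_nhds_unique h h2)

lemma aux_rd_empty (x : ℝ) : RDensity0 ∅ x := by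
  unfold RDensity0
  simp


lemma aux_bddBelow {α : ℝ → ℝ} (hα : ∀ r, α r ∈ Icc (0:ℝ) Real.pi) (r : ℝ) : BddBelow {t : ℝ | RDensity0 {y | t < α y} r} := by
  refine ⟨0, fun t ht => ?_⟩
  by_contra! h
  refine aux_rd_univ r ?_
  refine aux_rd_mono ht fun y _ => ?_
  exact lt_of_lt_of_le h (hα y).1

lemma aux_bddAbove {α : ℝ → ℝ} (hα : ∀ r, α r ∈ Icc (0:ℝ) Real.pi) (r : ℝ) : BddAbove {t : ℝ | RDensity0 {y | α y < t} r} := by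
  refine ⟨Real.pi, fun t ht => ?_⟩
  by_contra! h
  refine aux_rd_univ r ?_
  refine aux_rd_mono ht fun y _ => ?_
  exact lt_of_le_of_lt (hα y).2 h

lemma aux_sup_mem {α : ℝ → ℝ} (hα : ∀ r, α r ∈ Icc (0:ℝ) Real.pi) (r : ℝ) : RDensity0 {y | Real.pi < α y} r := by
  refine aux_rd_mono (aux_rd_empty r) fun y hy => ?_
  exact absurd (hα y).2 (not_le.2 hy)

lemma aux_inf_mem {α : ℝ → ℝ} (hα : ∀ r, α r ∈ Icc (0:ℝ) Real.pi) (r : ℝ) : RDensity0 {y | α y < 0} r := by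
  refine aux_rd_mono (aux_rd_empty r) fun y hy => ?_
  exact absurd (hα y).1 (not_le.2 hy)

lemma aux_sup_le {α : ℝ → ℝ} (hα : ∀ r, α r ∈ Icc (0:ℝ) Real.pi) (r : ℝ) {θ : ℝ} (h : RDensity0 {y | θ < α y} r) : apSup α r ≤ θ :=
  csInf_le (aux_bddBelow hα r) h

lemma aux_le_inf {α : ℝ → ℝ} (hα : ∀ r, α r ∈ Icc (0:ℝ) Real.pi) (r : ℝ) {θ : ℝ} (h : RDensity0 {y | α y < θ} r) : θ ≤ apInf α r :=
  le_csSup (aux_bddAbove hα r) h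

lemma aux_sup_lt {α : ℝ → ℝ} (hα : ∀ r, α r ∈ Icc (0:ℝ) Real.pi) (r : ℝ) {θ : ℝ} (h : apSup α r < θ) : ∃ t < θ, RDensity0 {y | t < α y} r := by
  obtain ⟨t, ht, ht2⟩ := exists_lt_of_csInf_lt ⟨_, aux_sup_mem hα r⟩ h
  exact ⟨t, ht2, ht⟩

lemma aux_lt_inf {α : ℝ → ℝ} (hα : ∀ r, α r ∈ Icc (0:ℝ) Real.pi) (r : ℝ) {θ : ℝ} (h : θ < apInf α r) : ∃ t > θ, RDensity0 {y | α y < t} r := by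
  obtain ⟨t, ht, ht2⟩ := exists_lt_of_lt_csSup ⟨_, aux_inf_mem hα r⟩ h
  exact ⟨t, ht2, ht⟩

lemma aux_type {α : ℝ → ℝ} (hα : ∀ r, α r ∈ Icc (0:ℝ) Real.pi)
    (hm : Measurable α) {r : ℝ} {θ : ℝ} (hG : auxGood α r θ) (h1 : apInf α r < θ)
    (h2 : θ < apSup α r) :
    ∃ δ > 0, (volume ({t | θ < α t} ∩ Ioo r (r + δ)) = 0 ∧
        volume ({t | θ < α t}ᶜ ∩ Ioo (r - δ) r) = 0) ∨
      (volume ({t | θ < α t}ᶜ ∩ Ioo r (r + δ)) = 0 ∧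
        volume ({t | θ < α t} ∩ Ioo (r - δ) r) = 0) := by
  obtain ⟨δ, hδ, h⟩ := hG
  have hA : MeasurableSet {t | θ < α t} := measurableSet_lt measurable_const hm
  have hR := aux_dichotomy hA (a := r) (b := r + δ) (fun s hs => h s
    (abs_pos.2 (by linarith [hs.1])) (abs_lt.2 ⟨by linarith [hs.1], by linarith [hs.2]⟩))
  have hL := aux_dichotomy hA (a := r - δ) (b := r) (fun s hs => h s
    (abs_pos.2 (by linarith [hs.2])) (abs_lt.2 ⟨by linarith [hs.1], by linarith [hs.2]⟩))
  refine ⟨δ, hδ, ?_⟩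
  rcases hR with hR | hR <;> rcases hL with hL | hL
  · exact absurd (aux_sup_le hα r (aux_rd_null hδ hR hL)) (not_le.2 h2)
  · exact Or.inl ⟨hR, hL⟩
  · exact Or.inr ⟨hR, hL⟩
  · refine absurd (aux_le_inf hα r (aux_rd_mono (aux_rd_null hδ hR hL) ?_)) (not_le.2 h1)
    intro y hy
    have hy' : α y < θ := hy
    exact not_lt.2 hy'.le

/-- Two good heights have the same type. -/
lemma aux_type2 {α : ℝ → ℝ} (hα : ∀ r, α r ∈ Icc (0:ℝ) Real.pi)
    (hm : Measurable α) {r : ℝ} {θ₁ θ₂ : ℝ} (hG₁ : auxGood α r θ₁)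
    (hG₂ : auxGood α r θ₂) (h12 : θ₁ < θ₂) (h1 : apInf α r < θ₁) (h2 : θ₂ < apSup α r) :
    ∃ δ > 0, (volume ({t | θ₁ < α t} ∩ Ioo r (r + δ)) = 0 ∧
        volume ({t | θ₂ < α t}ᶜ ∩ Ioo (r - δ) r) = 0) ∨
      (volume ({t | θ₂ < α t}ᶜ ∩ Ioo r (r + δ)) = 0 ∧
        volume ({t | θ₁ < α t} ∩ Ioo (r - δ) r) = 0) := by
  obtain ⟨δ₁, hδ₁, H₁⟩ := aux_type hα hm hG₁ h1 (h12.trans h2)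
  obtain ⟨δ₂, hδ₂, H₂⟩ := aux_type hα hm hG₂ (h1.trans h12) h2
  set δ := min δ₁ δ₂ with hδ
  have hδ0 : 0 < δ := lt_min hδ₁ hδ₂
  have hd1 : δ ≤ δ₁ := min_le_left _ _
  have hd2 : δ ≤ δ₂ := min_le_right _ _
  have R : ∀ (S : Set ℝ) (d : ℝ), δ ≤ d → volume (S ∩ Ioo r (r + d)) = 0 →
      volume (S ∩ Ioo r (r + δ)) = 0 := fun S d hd h =>
    measure_mono_null (inter_subset_inter_right _ (Ioo_subset_Ioo_right (by linarith))) h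
  have L : ∀ (S : Set ℝ) (d : ℝ), δ ≤ d → volume (S ∩ Ioo (r - d) r) = 0 →
      volume (S ∩ Ioo (r - δ) r) = 0 := fun S d hd h =>
    measure_mono_null (inter_subset_inter_right _ (Ioo_subset_Ioo_left (by linarith))) h
  have clash : ∀ (S T I : Set ℝ) , S ∪ T = univ → volume (S ∩ I) = 0 → volume (T ∩ I) = 0 →
      volume I = 0 := by
    intro S T I hST hS hT
    refine measure_mono_null ?_ (measure_union_null hS hT)
    rw [← union_inter_distrib_right, hST, univ_inter]
  have hU : {t | θ₁ < α t} ∪ {t | θ₂ < α t}ᶜ = univ := by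
    ext t
    simp only [mem_union, mem_ofPred_eq, mem_compl_iff, not_lt, mem_univ, iff_true]
    rcases le_or_gt (α t) θ₂ with h | h
    · exact Or.inr h
    · exact Or.inl (h12.trans h)
  have hIR : volume (Ioo r (r + δ)) ≠ 0 := by
    rw [Real.volume_Ioo]; simpa using hδ0
  have hIL : volume (Ioo (r - δ) r) ≠ 0 := by
    rw [Real.volume_Ioo]; simpa using hδ0
  refine ⟨δ, hδ0, ?_⟩
  rcases H₁ with ⟨a, b⟩ | ⟨a, b⟩ <;> rcases H₂ with ⟨c, d⟩ | ⟨c, d⟩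
  · exact Or.inl ⟨R _ _ hd1 a, L _ _ hd2 d⟩
  · exact absurd (clash _ _ _ hU (R _ _ hd1 a) (R _ _ hd2 c)) hIR
  · exact absurd (clash _ _ _ hU (L _ _ hd1 b) (L _ _ hd2 d)) hIL
  · exact Or.inr ⟨R _ _ hd2 c, L _ _ hd1 b⟩

lemma aux_ang_cont {n : ℕ} (p : Euc n) {x : Euc n} (hx : x ≠ 0) :
    ContinuousAt (fun y : Euc n => Real.arccos ⟪hatv y, p⟫) x := by
  refine Real.continuous_arccos.continuousAt.comp ?_
  have : ContinuousAt (fun y : Euc n => hatv y) x :=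
    (continuous_norm.continuousAt.inv₀ (norm_ne_zero_iff.2 hx)).smul continuousAt_id
  exact this.inner continuousAt_const

lemma aux_mem_red {n : ℕ} (hn : 2 ≤ n) {α : ℝ → ℝ} (hm : Measurable α) (p : Euc n) {x : Euc n}
    (hx : x ≠ 0) {θ₁ θ₂ δ : ℝ} (hδ : 0 < δ) (h1 : θ₁ < Real.arccos ⟪hatv x, p⟫)
    (h2 : Real.arccos ⟪hatv x, p⟫ < θ₂)
    (H : (volume ({t | θ₁ < α t} ∩ Ioo ‖x‖ (‖x‖ + δ)) = 0 ∧
        volume ({t | θ₂ < α t}ᶜ ∩ Ioo (‖x‖ - δ) ‖x‖) = 0) ∨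
      (volume ({t | θ₂ < α t}ᶜ ∩ Ioo ‖x‖ (‖x‖ + δ)) = 0 ∧
        volume ({t | θ₁ < α t} ∩ Ioo (‖x‖ - δ) ‖x‖) = 0)) :
    x ∈ redBoundary (sphSymm n α p) := by
  have hA : MeasurableSet {t | θ₁ < α t} := measurableSet_lt measurable_const hm
  have hB : MeasurableSet {t | θ₂ < α t}ᶜ := (measurableSet_lt measurable_const hm).compl
  have hc := aux_ang_cont p hx
  have e1 := hc.eventually (lt_mem_nhds h1)
  have e2 := hc.eventually (gt_mem_nhds h2)
  have e3 : ∀ᶠ y in 𝓝 x, y ≠ 0 := isOpen_ne.mem_nhds hx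
  have e4 : ∀ᶠ y : Euc n in 𝓝 x, ‖y‖ < ‖x‖ + δ :=
    continuous_norm.continuousAt.eventually (gt_mem_nhds (by linarith))
  have e5 : ∀ᶠ y : Euc n in 𝓝 x, ‖x‖ - δ < ‖y‖ :=
    continuous_norm.continuousAt.eventually (lt_mem_nhds (by linarith))
  have eF : ∀ᶠ y in 𝓝 x, y ∈ sphSymm n α p → ‖y‖ ∈ {t | θ₁ < α t} := by
    filter_upwards [e1] with y hy hyF
    exact hy.trans hyF.2
  have eFc : ∀ᶠ y in 𝓝 x, y ∈ (sphSymm n α p)ᶜ → ‖y‖ ∈ {t | θ₂ < α t}ᶜ := by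
    filter_upwards [e2, e3] with y hy hy0 hyF
    intro hlt
    exact hyF ⟨hy0, lt_trans hy hlt⟩
  rcases H with ⟨a, b⟩ | ⟨a, b⟩
  · refine ⟨hatv x, aux_norm_hat hx, ?_, ?_⟩
    · refine aux_H1 hn x hx (S := sphSymm n α p) (hA.inter measurableSet_Ioo) a ?_
      filter_upwards [eF, e4] with y h h' hy hlt
      exact ⟨h hy, hlt, h'⟩
    · refine aux_H2 hn x hx (S := (sphSymm n α p)ᶜ) (hB.inter measurableSet_Ioo) b ?_
      filter_upwards [eFc, e5] with y h h' hy hlt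
      exact ⟨h hy, h', hlt⟩
  · refine ⟨-hatv x, by rw [norm_neg]; exact aux_norm_hat hx, ?_, ?_⟩
    · have := aux_H2 hn x hx (S := sphSymm n α p) (hA.inter measurableSet_Ioo) b (by
        filter_upwards [eF, e5] with y h h' hy hlt
        exact ⟨h hy, h', hlt⟩)
      simp only [inner_neg_right, Left.neg_pos_iff]
      exact this
    · have := aux_H1 hn x hx (S := (sphSymm n α p)ᶜ) (hB.inter measurableSet_Ioo) a (by
        filter_upwards [eFc, e4] with y h h' hy hlt
        exact ⟨h hy, hlt, h'⟩)
      simp only [inner_neg_right, Left.neg_neg_iff]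
      exact this

lemma aux_final {n : ℕ} (hn : 2 ≤ n) {α : ℝ → ℝ} (hm : Measurable α)
    (hα : ∀ r, α r ∈ Icc (0:ℝ) Real.pi) {p : Euc n} (hp : ‖p‖ = 1)
    (hF : perim (sphSymm n α p) univ < ⊤) {r : ℝ} (hr : 0 < r) :
    μH[(n : ℝ) - 1] (symmDiff (redBoundary (sphSymm n α p) ∩ sphere (0 : Euc n) r)
        (capSet p r (apSup α r) \ capSet p r (apInf α r))) = 0 := by
  set G : Set ℝ := {θ | auxGood α r θ ∧ apInf α r < θ ∧ θ < apSup α r} with hG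
  have hGa : BddAbove G := ⟨apSup α r, fun θ h => h.2.2.le⟩
  have hGb : BddBelow G := ⟨apInf α r, fun θ h => h.2.1.le⟩
  have hlat := fun θ => aux_latitude hn hp hr θ
  refine measure_mono_null ?_ (measure_union_null (measure_union_null (measure_union_null
    (measure_union_null (hlat (apSup α r)) (hlat (apInf α r))) (hlat (sInf G))) (hlat (sSup G)))
    (aux_bad_null hn hm hp hF hr))
  rintro x (⟨⟨hx, hxr⟩, hnot⟩ | ⟨⟨⟨hxr, hsup⟩, hinf⟩, hnot⟩)
  · have hxn : ‖x‖ = r := by simpa using hxr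
    have hx0 : x ≠ 0 := by rintro rfl; rw [norm_zero] at hxn; linarith
    obtain ⟨n1, n2⟩ := aux_red_not0 hn hx
    have hc := aux_ang_cont p hx0
    rcases lt_trichotomy (Real.arccos ⟪hatv x, p⟫) (apSup α r) with h | h | h
    · have hlt : Real.arccos ⟪hatv x, p⟫ < apInf α r := by
        by_contra! h'
        exact hnot ⟨⟨hxr, h⟩, fun h2 => absurd h2.2 (not_lt.2 h')⟩
      obtain ⟨t, ht, htd⟩ := aux_lt_inf hα r hlt
      refine absurd ?_ n2
      rw [← hxn] at htd
      refine auxD0_mono_ev (aux_radial_D0 hn x hx0 (measurableSet_lt hm measurable_const) htd) ?_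
      filter_upwards [hc.eventually (gt_mem_nhds ht), isOpen_ne.mem_nhds hx0] with y hy hy0 hyF
      show α ‖y‖ < t
      by_contra! hcon
      exact hyF ⟨hy0, lt_of_lt_of_le hy hcon⟩
    · exact Or.inl (Or.inl (Or.inl (Or.inl ⟨hxn, h⟩)))
    · obtain ⟨t, ht, htd⟩ := aux_sup_lt hα r h
      refine absurd ?_ n1
      rw [← hxn] at htd
      refine auxD0_mono_ev (aux_radial_D0 hn x hx0 (measurableSet_lt measurable_const hm) htd) ?_
      filter_upwards [hc.eventually (lt_mem_nhds ht)] with y hy hyF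
      exact lt_trans hy hyF.2
  · have hxn : ‖x‖ = r := by simpa using hxr
    have hx0 : x ≠ 0 := by rintro rfl; rw [norm_zero] at hxn; linarith
    by_contra hcon
    simp only [mem_union, mem_ofPred_eq, hxn, true_and, not_or] at hcon
    obtain ⟨⟨⟨⟨-, c2⟩, c3⟩, c4⟩, c5⟩ := hcon
    have hge : apInf α r ≤ Real.arccos ⟪hatv x, p⟫ := by
      by_contra! h
      exact hinf ⟨hxr, h⟩
    have hgt : apInf α r < Real.arccos ⟪hatv x, p⟫ := lt_of_le_of_ne hge (Ne.symm c2)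
    have hgood : auxGood α r (Real.arccos ⟪hatv x, p⟫) := by
      by_contra h
      refine c5 ⟨?_, ?_, h⟩
      · exact lt_of_le_of_lt (aux_le_inf hα r (aux_inf_mem hα r)) hgt
      · exact lt_of_lt_of_le hsup (aux_sup_le hα r (aux_sup_mem hα r))
    have hmem : Real.arccos ⟪hatv x, p⟫ ∈ G := ⟨hgood, hgt, hsup⟩
    obtain ⟨θ₁, g1, l1⟩ := exists_lt_of_csInf_lt ⟨_, hmem⟩
      (lt_of_le_of_ne (csInf_le hGb hmem) (Ne.symm c3))
    obtain ⟨θ₂, g2, l2⟩ := exists_lt_of_lt_csSup ⟨_, hmem⟩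
      (lt_of_le_of_ne (le_csSup hGa hmem) c4)
    obtain ⟨δ, hδ, H⟩ := aux_type2 hα hm g1.1 g2.1 (l1.trans l2) g1.2.1 g2.2.2
    refine hnot ⟨aux_mem_red hn hm p hx0 hδ l1 l2 ?_, hxr⟩
    rw [hxn]
    exact H

/-- **Lemma 8.2.** For every `r̄ > 0` the slice `(∂*F_v)_{r̄}` is `H^{n-1}`-equivalent to
`B_{α_v^∨(r̄)}(r̄ e₁) \ B_{α_v^∧(r̄)}(r̄ e₁)`. -/
theorem symmetral_reduced_boundary_slice
    (n : ℕ) (hn : 2 ≤ n)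
    (v : ℝ → ℝ) (hv_meas : Measurable v) (hv_nonneg : ∀ r ∈ Ioi (0:ℝ), 0 ≤ v r)
    (hv_le : ∀ᵐ r ∂(volume.restrict (Ioi (0:ℝ))),
      v r ≤ (n : ℝ) * omegaBall n * r ^ (n - 1))
    (α : ℝ → ℝ) (hα_meas : Measurable α) (hα_mem : ∀ r, α r ∈ Icc (0:ℝ) Real.pi)
    (hα : ∀ᵐ r ∂(volume.restrict (Ioi (0:ℝ))),
      μH[(n : ℝ) - 1] (capSet (e1 n (by omega)) r (α r)) = ENNReal.ofReal (v r))
    (hF_perim : perim (sphSymm n α (e1 n (by omega))) univ < ⊤)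
    (hF_vol : volume (sphSymm n α (e1 n (by omega))) < ⊤)
 :
    ∀ r : ℝ, 0 < r →
      μH[(n : ℝ) - 1] (symmDiff
        (redBoundary (sphSymm n α (e1 n (by omega))) ∩ sphere (0 : Euc n) r)
        (capSet (e1 n (by omega)) r (apSup α r) \ capSet (e1 n (by omega)) r (apInf α r))) = 0 := by
  intro r hr
  have hp : ‖e1 n (by omega)‖ = 1 := by simp [e1]
  exact aux_final hn hα_meas hα_mem hp hF_perim hr
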